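/- arXiv:1209.0501 — 2 statements merged into one kernel-verified Lean document; each statement's English description precedes it below -/
import Mathlib

section
/- Let X be a separable infinite-dimensional real Banach space. Then X admits an equivalent norm with property (β) of Rolewicz if and only if X is reflexive and admits both an equivalent asymptotically uniformly smooth norm and an equivalent asymptotically uniformly convex norm. -/
open Set Metric Filter Topology

noncomputable section

/-- `T` is a uniform quotient map on `S`: uniformly continuous and co-uniformly
continuous (with closed balls). -/
def UniformQuotientOn {X Y : Type*} [NormedAddCommGroup X] [NormedAddCommGroup Y]
    (T : X → Y) (S : Set X) : Prop :=
  (∀ ε > 0, ∃ δ > 0, ∀ x ∈ S, ∀ x' ∈ S, ‖x - x'‖ ≤ δ → ‖T x - T x'‖ ≤ ε) ∧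
  (∀ ε > 0, ∃ δ > 0, ∀ x ∈ S, closedBall (T x) δ ⊆ T '' (closedBall x ε ∩ S))

/-- The set of ratios `‖Tx - Tx'‖ / ‖x - x'‖` over pairs of points of `S` at distance `≥ d`. -/
def LargeDistRatioSet {X Y : Type*} [NormedAddCommGroup X] [NormedAddCommGroup Y]
    (T : X → Y) (S : Set X) (d : ℝ) : Set ℝ :=
  {r | ∃ x ∈ S, ∃ x' ∈ S, d ≤ ‖x - x'‖ ∧ r = ‖T x - T x'‖ / ‖x - x'‖}

/-- `L_d^T`, the Lipschitz constant of `T` for distances `≥ d`. -/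
noncomputable def Ld {X Y : Type*} [NormedAddCommGroup X] [NormedAddCommGroup Y]
    (T : X → Y) (S : Set X) (d : ℝ) : ℝ :=
  sSup (LargeDistRatioSet T S d)

/-- `T` is Lipschitz for large distances: `L_d^T < ∞` for every `d > 0`. -/
def LipschitzLargeDist {X Y : Type*} [NormedAddCommGroup X] [NormedAddCommGroup Y]
    (T : X → Y) (S : Set X) : Prop :=
  ∀ d > 0, BddAbove (LargeDistRatioSet T S d)

/-- The set of co-Lipschitz constants valid for all radii `r ≥ d`. -/
def CoLipSet {X Y : Type*} [NormedAddCommGroup X] [NormedAddCommGroup Y]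
    (T : X → Y) (S : Set X) (d : ℝ) : Set ℝ :=
  {c | 0 < c ∧ ∀ r, d ≤ r → ∀ x ∈ S, ∀ y : Y, ‖y - T x‖ < c * r →
      y ∈ T '' (closedBall x r ∩ S)}

/-- `c_d^T`. -/
noncomputable def cdT {X Y : Type*} [NormedAddCommGroup X] [NormedAddCommGroup Y]
    (T : X → Y) (S : Set X) (d : ℝ) : ℝ :=
  sSup (CoLipSet T S d)

/-- `C^T = lim_{d → ∞} c_d^T` (the limit of the nondecreasing family `c_d^T`,
i.e. its supremum). -/
noncomputable def CT {X Y : Type*} [NormedAddCommGroup X] [NormedAddCommGroup Y]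
    (T : X → Y) (S : Set X) : ℝ :=
  sSup {c | ∃ d, 0 < d ∧ c = cdT T S d}

/-- The set of admissible `δ`'s in the definition of the modulus `β̄_X(t)`. -/
def betaModSet (X : Type*) [NormedAddCommGroup X] (t : ℝ) : Set ℝ :=
  {δ | 0 ≤ δ ∧ ∀ x ∈ closedBall (0 : X) 1, ∀ xs : ℕ → X,
      (∀ n, xs n ∈ closedBall (0 : X) 1) →
      (∀ m n, m ≠ n → t ≤ ‖xs m - xs n‖) →
      ∃ n, ‖x - xs n‖ / 2 ≤ 1 - δ}

/-- The modulus `β̄_X(t)` of property (β) of Rolewicz. -/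
noncomputable def betaMod (X : Type*) [NormedAddCommGroup X] (t : ℝ) : ℝ :=
  sSup (betaModSet X t)

/-- Property (β) of Rolewicz. -/
def PropertyBeta (X : Type*) [NormedAddCommGroup X] : Prop :=
  ∃ a, 1 ≤ a ∧ a ≤ 2 ∧ ∀ t, 0 < t → t ≤ a → ∃ δ, 0 < δ ∧
    ∀ x ∈ closedBall (0 : X) 1, ∀ xs : ℕ → X,
      (∀ n, xs n ∈ closedBall (0 : X) 1) →
      (∀ m n, m ≠ n → t ≤ ‖xs m - xs n‖) →
      ∃ n, ‖x - xs n‖ / 2 ≤ 1 - δ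

/-- `Z` is a closed subspace of finite codimension. -/
def FinCodim {Y : Type*} [NormedAddCommGroup Y] [NormedSpace ℝ Y] (Z : Subspace ℝ Y) : Prop :=
  IsClosed (Z : Set Y) ∧ FiniteDimensional ℝ (Y ⧸ Z)

/-- `ρ̄_Y(t, y) = inf_Z sup_{z ∈ S_Z} (‖y + tz‖ - 1)`. -/
noncomputable def rhoAt {Y : Type*} [NormedAddCommGroup Y] [NormedSpace ℝ Y]
    (t : ℝ) (y : Y) : ℝ :=
  sInf {s | ∃ Z : Subspace ℝ Y, FinCodim Z ∧
    s = sSup {r | ∃ z ∈ Z, ‖z‖ = 1 ∧ r = ‖y + t • z‖ - 1}}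

/-- The modulus of asymptotic uniform smoothness `ρ̄_Y(t)`. -/
noncomputable def rhoMod (Y : Type*) [NormedAddCommGroup Y] [NormedSpace ℝ Y] (t : ℝ) : ℝ :=
  sSup {r | ∃ y : Y, ‖y‖ = 1 ∧ r = rhoAt t y}

/-- `δ̄_Y(t, y) = sup_Z inf_{z ∈ S_Z} (‖y + tz‖ - 1)`. -/
noncomputable def deltaAt {Y : Type*} [NormedAddCommGroup Y] [NormedSpace ℝ Y]
    (t : ℝ) (y : Y) : ℝ :=
  sSup {s | ∃ Z : Subspace ℝ Y, FinCodim Z ∧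
    s = sInf {r | ∃ z ∈ Z, ‖z‖ = 1 ∧ r = ‖y + t • z‖ - 1}}

/-- The modulus of asymptotic uniform convexity `δ̄_Y(t)`. -/
noncomputable def deltaMod (Y : Type*) [NormedAddCommGroup Y] [NormedSpace ℝ Y] (t : ℝ) : ℝ :=
  sInf {r | ∃ y : Y, ‖y‖ = 1 ∧ r = deltaAt t y}

/-- The norm of `Y` is asymptotically uniformly smooth. -/
def AUS (Y : Type*) [NormedAddCommGroup Y] [NormedSpace ℝ Y] : Prop :=
  Tendsto (fun t => rhoMod Y t / t) (𝓝[>] 0) (𝓝 0)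

/-- The norm of `Y` is asymptotically uniformly convex. -/
def AUC (Y : Type*) [NormedAddCommGroup Y] [NormedSpace ℝ Y] : Prop :=
  ∀ t > 0, 0 < deltaMod Y t

/-- A sequence is basic with basis constant at most `K`. -/
def IsBasicWithConst {Y : Type*} [NormedAddCommGroup Y] [NormedSpace ℝ Y]
    (K : ℝ) (e : ℕ → Y) : Prop :=
  ∀ (a : ℕ → ℝ) (m n : ℕ), m ≤ n →
    ‖∑ i ∈ Finset.range m, a i • e i‖ ≤ K * ‖∑ i ∈ Finset.range n, a i • e i‖

/-- A weakly null sequence. -/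
def WeaklyNull {Y : Type*} [NormedAddCommGroup Y] [NormedSpace ℝ Y] (xs : ℕ → Y) : Prop :=
  ∀ f : Y →L[ℝ] ℝ, Tendsto (fun n => f (xs n)) atTop (𝓝 0)

/-- Property (M) of Kalton. -/
def PropertyM (Y : Type*) [NormedAddCommGroup Y] [NormedSpace ℝ Y] : Prop :=
  ∀ u v : Y, ‖u‖ = 1 → ‖v‖ = 1 → ∀ xs : ℕ → Y, WeaklyNull xs →
    limsup (fun n => ‖u + xs n‖) atTop = limsup (fun n => ‖v + xs n‖) atTop

/-- `N` is a norm on `X` equivalent to the given one. -/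
def IsEquivNorm {X : Type*} [NormedAddCommGroup X] [NormedSpace ℝ X] (N : X → ℝ) : Prop :=
  (∀ x y, N (x + y) ≤ N x + N y) ∧
  (∀ (a : ℝ) (x : X), N (a • x) = |a| * N x) ∧
  (∃ c > 0, ∃ C > 0, ∀ x : X, c * ‖x‖ ≤ N x ∧ N x ≤ C * ‖x‖)

/-- The norm `N` has property (β) of Rolewicz. -/
def NormHasPropertyBeta {X : Type*} [NormedAddCommGroup X] (N : X → ℝ) : Prop :=
  ∃ a, 1 ≤ a ∧ a ≤ 2 ∧ ∀ t, 0 < t → t ≤ a → ∃ δ, 0 < δ ∧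
    ∀ x : X, N x ≤ 1 → ∀ xs : ℕ → X, (∀ n, N (xs n) ≤ 1) →
      (∀ m n, m ≠ n → t ≤ N (xs m - xs n)) →
      ∃ n, N (x - xs n) / 2 ≤ 1 - δ

/-- `ρ̄(t, x)` for an abstract norm `N` on `X`. -/
noncomputable def rhoAtNorm {X : Type*} [NormedAddCommGroup X] [NormedSpace ℝ X]
    (N : X → ℝ) (t : ℝ) (x : X) : ℝ :=
  sInf {s | ∃ Z : Subspace ℝ X, FinCodim Z ∧
    s = sSup {r | ∃ z ∈ Z, N z = 1 ∧ r = N (x + t • z) - 1}}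

/-- The modulus of asymptotic uniform smoothness of the norm `N`. -/
noncomputable def rhoModNorm {X : Type*} [NormedAddCommGroup X] [NormedSpace ℝ X]
    (N : X → ℝ) (t : ℝ) : ℝ :=
  sSup {r | ∃ x : X, N x = 1 ∧ r = rhoAtNorm N t x}

/-- `δ̄(t, x)` for an abstract norm `N` on `X`. -/
noncomputable def deltaAtNorm {X : Type*} [NormedAddCommGroup X] [NormedSpace ℝ X]
    (N : X → ℝ) (t : ℝ) (x : X) : ℝ :=
  sSup {s | ∃ Z : Subspace ℝ X, FinCodim Z ∧
    s = sInf {r | ∃ z ∈ Z, N z = 1 ∧ r = N (x + t • z) - 1}}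

/-- The modulus of asymptotic uniform convexity of the norm `N`. -/
noncomputable def deltaModNorm {X : Type*} [NormedAddCommGroup X] [NormedSpace ℝ X]
    (N : X → ℝ) (t : ℝ) : ℝ :=
  sInf {r | ∃ x : X, N x = 1 ∧ r = deltaAtNorm N t x}

/-- The norm `N` is asymptotically uniformly smooth. -/
def AUSNorm {X : Type*} [NormedAddCommGroup X] [NormedSpace ℝ X] (N : X → ℝ) : Prop :=
  Tendsto (fun t => rhoModNorm N t / t) (𝓝[>] 0) (𝓝 0)

/-- The norm `N` is asymptotically uniformly convex. -/
def AUCNorm {X : Type*} [NormedAddCommGroup X] [NormedSpace ℝ X] (N : X → ℝ) : Prop :=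
  ∀ t > 0, 0 < deltaModNorm N t

section HelperLemmas

variable {X : Type*} [NormedAddCommGroup X] [NormedSpace ℝ X]

namespace IsEquivNorm

variable {N : X → ℝ}

lemma add_le (h : IsEquivNorm N) (x y : X) : N (x + y) ≤ N x + N y := h.1 x y

lemma smul (h : IsEquivNorm N) (a : ℝ) (x : X) : N (a • x) = |a| * N x := h.2.1 a x

lemma smul_nn (h : IsEquivNorm N) {a : ℝ} (ha : 0 ≤ a) (x : X) : N (a • x) = a * N x := by
  rw [h.smul, abs_of_nonneg ha]

lemma zero (h : IsEquivNorm N) : N 0 = 0 := by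
  have := h.smul 0 0
  simpa using this

lemma neg (h : IsEquivNorm N) (x : X) : N (-x) = N x := by
  have := h.smul (-1) x
  simpa using this

lemma nonneg (h : IsEquivNorm N) (x : X) : 0 ≤ N x := by
  have h1 := h.add_le x (-x)
  rw [h.neg, add_neg_cancel, h.zero] at h1
  linarith

lemma sub_le (h : IsEquivNorm N) (x y : X) : N (x - y) ≤ N x + N y := by
  have h1 := h.add_le x (-y)
  rwa [h.neg, ← sub_eq_add_neg] at h1

lemma le_sub (h : IsEquivNorm N) (x y : X) : N x - N y ≤ N (x - y) := by
  have h1 := h.add_le (x - y) y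
  rw [sub_add_cancel] at h1
  linarith

lemma le_add' (h : IsEquivNorm N) (x y : X) : N x - N y ≤ N (x + y) := by
  have h1 := h.le_sub x (-y)
  rwa [h.neg, sub_neg_eq_add] at h1

lemma sub_comm (h : IsEquivNorm N) (x y : X) : N (x - y) = N (y - x) := by
  rw [← h.neg, neg_sub]

lemma eq_zero (h : IsEquivNorm N) {x : X} (hx : N x = 0) : x = 0 := by
  obtain ⟨c, hc, C, hC, hb⟩ := h.2.2
  have h1 := (hb x).1
  rw [hx] at h1
  have : ‖x‖ ≤ 0 := by
    by_contra hh
    push Not at hh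
    have := mul_pos hc hh
    linarith
  simpa using this

lemma pos (h : IsEquivNorm N) {x : X} (hx : x ≠ 0) : 0 < N x :=
  lt_of_le_of_ne (h.nonneg x) (fun h' => hx (h.eq_zero h'.symm))

/-- convexity in segment form -/
lemma conv (h : IsEquivNorm N) {a b : ℝ} (ha : 0 ≤ a) (hb : 0 ≤ b) (x y : X) :
    N (a • x + b • y) ≤ a * N x + b * N y := by
  have := h.add_le (a • x) (b • y)
  rwa [h.smul_nn ha, h.smul_nn hb] at this

/-- norming functional -/
lemma exists_norming (h : IsEquivNorm N) (x : X) :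
    ∃ f : X →L[ℝ] ℝ, f x = N x ∧ ∀ y, f y ≤ N y := by
  by_cases hx : x = 0
  · subst hx
    exact ⟨0, by simp [h.zero], fun y => by simpa using h.nonneg y⟩
  obtain ⟨g, hg1, hg2⟩ := exists_extension_of_le_sublinear
    (LinearPMap.mkSpanSingleton x (N x) hx) N (fun c hc y => h.smul_nn hc.le y) h.1 (by
      rintro ⟨y, hy⟩
      obtain ⟨c, rfl⟩ := Submodule.mem_span_singleton.1 hy
      rw [LinearPMap.mkSpanSingleton'_apply]
      simp only [smul_eq_mul]
      rw [h.smul]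
      exact mul_le_mul_of_nonneg_right (le_abs_self c) (h.nonneg x))
  obtain ⟨c, hc, C, hC, hb⟩ := h.2.2
  have hgx : g x = N x := by
    have := hg1 ⟨x, Submodule.mem_span_singleton_self x⟩
    simp only at this
    rw [this]
    exact LinearPMap.mkSpanSingleton_apply ℝ ℝ hx (N x)
  refine ⟨g.mkContinuous C (fun y => ?_), by simpa using hgx, fun y => by simpa using hg2 y⟩
  rw [Real.norm_eq_abs, abs_le]
  constructor
  · have := hg2 (-y)
    rw [map_neg, h.neg] at this
    linarith [(hb y).2]
  · exact (hg2 y).trans (hb y).2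

lemma abs_le_of_le (h : IsEquivNorm N) {f : X →L[ℝ] ℝ} (hf : ∀ y, f y ≤ N y) (y : X) :
    |f y| ≤ N y := by
  rw [abs_le]
  have := hf (-y)
  rw [map_neg, h.neg] at this
  exact ⟨by linarith, hf y⟩

lemma continuous (h : IsEquivNorm N) : Continuous N := by
  obtain ⟨c, hc, C, hC, hb⟩ := h.2.2
  have : LipschitzWith ⟨C, hC.le⟩ N := by
    apply LipschitzWith.of_dist_le_mul
    intro x y
    rw [Real.dist_eq, dist_eq_norm, abs_le]
    have h1 := h.le_sub x y
    have h2 := h.le_sub y x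
    rw [h.sub_comm y x] at h2
    have h3 := (hb (x - y)).2
    constructor
    · show -(C * _) ≤ _
      linarith
    · show _ ≤ C * _
      linarith
  exact this.continuous

end IsEquivNorm

/-! ### finite codimension filter -/

lemma FinCodim.inf {Z W : Subspace ℝ X} (hZ : FinCodim Z) (hW : FinCodim W) :
    FinCodim (Z ⊓ W) := by
  refine ⟨?_, ?_⟩
  · rw [Submodule.coe_inf]
    exact hZ.1.inter hW.1
  · have h1 : Submodule.CoFG Z := hZ.2
    have h2 : Submodule.CoFG W := hW.2
    exact h1.inf h2

lemma FinCodim.top : FinCodim (⊤ : Subspace ℝ X) := by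
  refine ⟨by simp, ?_⟩
  infer_instance

lemma FinCodim.ker (f : X →L[ℝ] ℝ) : FinCodim (f : X →ₗ[ℝ] ℝ).ker := by
  refine ⟨f.isClosed_ker, ?_⟩
  exact (f : X →ₗ[ℝ] ℝ).quotKerEquivRange.symm.finiteDimensional

/-- filter generated by the closed finite-codimensional subspaces -/
def fcf (X : Type*) [NormedAddCommGroup X] [NormedSpace ℝ X] : Filter X where
  sets := {s | ∃ Z : Subspace ℝ X, FinCodim Z ∧ (Z : Set X) ⊆ s}
  univ_sets := ⟨⊤, FinCodim.top, by simp⟩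
  sets_of_superset := by
    rintro s t ⟨Z, hZ, h⟩ hst
    exact ⟨Z, hZ, h.trans hst⟩
  inter_sets := by
    rintro s t ⟨Z, hZ, h⟩ ⟨W, hW, h'⟩
    exact ⟨Z ⊓ W, hZ.inf hW, fun x hx => ⟨h hx.1, h' hx.2⟩⟩

lemma ev_fcf {P : X → Prop} : (∀ᶠ w in fcf X, P w) ↔ ∃ Z : Subspace ℝ X, FinCodim Z ∧ ∀ w ∈ Z, P w :=
  Iff.rfl

lemma ev_smul {P : X → Prop} (h : ∀ᶠ w in fcf X, P w) (a : ℝ) : ∀ᶠ w in fcf X, P (a • w) := by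
  obtain ⟨Z, hZ, h⟩ := ev_fcf.1 h
  exact ev_fcf.2 ⟨Z, hZ, fun w hw => h _ (Z.smul_mem a hw)⟩

lemma ev_ker (f : X →L[ℝ] ℝ) : ∀ᶠ w in fcf X, f w = 0 :=
  ev_fcf.2 ⟨_, FinCodim.ker f, fun _ hw => hw⟩

lemma ev_zero {P : X → Prop} (h : ∀ᶠ w in fcf X, P w) : P 0 := by
  obtain ⟨Z, hZ, h⟩ := ev_fcf.1 h
  exact h 0 Z.zero_mem

lemma ev_lsc {N : X → ℝ} (hN : IsEquivNorm N) (x : X) : ∀ᶠ w in fcf X, N x ≤ N (x + w) := by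
  obtain ⟨f, hf, hfN⟩ := hN.exists_norming x
  filter_upwards [ev_ker f] with w hw
  have := hfN (x + w)
  rw [map_add, hw, hf] at this
  linarith

lemma ev_lsc' {N : X → ℝ} (hN : IsEquivNorm N) (x : X) : ∀ᶠ w in fcf X, N x ≤ N (x - w) := by
  filter_upwards [ev_smul (ev_lsc hN x) (-1)] with w hw
  simpa [sub_eq_add_neg] using hw

/-- extracting basic-like sequences -/
lemma exists_seq {N : X → ℝ} (hN : IsEquivNorm N) {Q : X → Prop} (h : ∃ᶠ w in fcf X, Q w) :
    ∃ u : ℕ → X, (∀ n, Q (u n)) ∧ ∀ m n, m < n → N (u m) ≤ N (u m - u n) := by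
  apply exists_seq_of_forall_finset_exists Q (fun x y => N x ≤ N (x - y))
  intro s _
  have h1 : ∀ᶠ w in fcf X, ∀ x ∈ s, N x ≤ N (x - w) :=
    (Filter.eventually_all_finset s).2 (fun x _ => ev_lsc' hN x)
  obtain ⟨y, hy1, hy2⟩ := (h.and_eventually h1).exists
  exact ⟨y, hy1, hy2⟩

lemma exists_unit (hX : ¬ FiniteDimensional ℝ X) {N : X → ℝ} (hN : IsEquivNorm N)
    {Z : Subspace ℝ X} (hZ : FinCodim Z) : ∃ z ∈ Z, N z = 1 := by
  have : Z ≠ ⊥ := by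
    rintro rfl
    apply hX
    have := hZ.2
    exact (Submodule.quotEquivOfEqBot (⊥ : Submodule ℝ X) rfl).finiteDimensional
  obtain ⟨z, hz, hz0⟩ := Z.ne_bot_iff.1 this
  have hp := hN.pos hz0
  exact ⟨(N z)⁻¹ • z, Z.smul_mem _ hz, by
    rw [hN.smul_nn (inv_nonneg.2 hp.le), inv_mul_cancel₀ hp.ne']⟩

lemma seg_upper {N : X → ℝ} (hN : IsEquivNorm N) {x w : X} {r s K : ℝ} (hx : N x ≤ 1)
    (hr : 0 ≤ r) (hrs : r ≤ s) (hs : 0 < s) (h : N (x + s • w) ≤ 1 + K * s) :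
    N (x + r • w) ≤ 1 + K * r := by
  have h1 : x + r • w = (1 - r / s) • x + (r / s) • (x + s • w) := by
    rw [smul_add, smul_smul, div_mul_cancel₀ _ hs.ne', sub_smul, one_smul]
    abel
  have hq : r / s ≤ 1 := (div_le_one hs).2 hrs
  have hq0 : 0 ≤ r / s := by positivity
  rw [h1]
  refine (hN.conv (by linarith) hq0 _ _).trans ?_
  have h2 : (r / s) * N (x + s • w) ≤ r / s * (1 + K * s) := mul_le_mul_of_nonneg_left h hq0
  have h3 : r / s * (1 + K * s) = r / s + K * r := by field_simp
  have h4 : (1 - r / s) * N x ≤ (1 - r / s) * 1 := mul_le_mul_of_nonneg_left hx (by linarith)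
  linarith

lemma rho_set_bdd {N : X → ℝ} (hN : IsEquivNorm N) {t : ℝ} (ht : 0 < t) {x : X} (hx : N x = 1)
    (Z : Subspace ℝ X) : ∀ r ∈ {r | ∃ z ∈ Z, N z = 1 ∧ r = N (x + t • z) - 1}, r ≤ t ∧ -1 ≤ r := by
  rintro r ⟨z, hz, hz1, rfl⟩
  have := hN.add_le x (t • z)
  rw [hN.smul_nn ht.le, hz1, hx] at this
  exact ⟨by linarith, by linarith [hN.nonneg (x + t • z)]⟩

lemma rho_sup_nonneg {N : X → ℝ} (hN : IsEquivNorm N) {t : ℝ} (ht : 0 < t) {x : X} (hx : N x = 1)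
    (Z : Subspace ℝ X) : 0 ≤ sSup {r | ∃ z ∈ Z, N z = 1 ∧ r = N (x + t • z) - 1} := by
  have hbdd : BddAbove {r | ∃ z ∈ Z, N z = 1 ∧ r = N (x + t • z) - 1} :=
    ⟨t, fun r hr => (rho_set_bdd hN ht hx Z r hr).1⟩
  by_cases h : ∃ z ∈ Z, N z = 1
  · obtain ⟨z, hz, hz1⟩ := h
    have h1 := le_csSup hbdd ⟨z, hz, hz1, rfl⟩
    have h2 := le_csSup hbdd ⟨-z, Z.neg_mem hz, by rw [hN.neg, hz1], rfl⟩
    have h3 := hN.add_le (x + t • z) (x + t • (-z))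
    have h4 : (x + t • z) + (x + t • (-z)) = (2 : ℝ) • x := by
      rw [smul_neg, two_smul]; abel
    rw [h4, hN.smul_nn (by norm_num), hx] at h3
    linarith
  · apply Real.sSup_nonneg
    rintro r ⟨z, hz, hz1, _⟩
    exact absurd ⟨z, hz, hz1⟩ h

lemma rhoAt_nonneg {N : X → ℝ} (hN : IsEquivNorm N) {t : ℝ} (ht : 0 < t) {x : X} (hx : N x = 1) :
    0 ≤ rhoAtNorm N t x := by
  apply Real.sInf_nonneg
  rintro s ⟨Z, hZ, rfl⟩
  exact rho_sup_nonneg hN ht hx Z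

lemma rhoAt_bddBelow {N : X → ℝ} (hN : IsEquivNorm N) {t : ℝ} (ht : 0 < t) {x : X} (hx : N x = 1) :
    BddBelow {s | ∃ Z : Subspace ℝ X, FinCodim Z ∧
    s = sSup {r | ∃ z ∈ Z, N z = 1 ∧ r = N (x + t • z) - 1}} := by
  refine ⟨0, ?_⟩
  rintro s ⟨Z, hZ, rfl⟩
  exact rho_sup_nonneg hN ht hx Z

lemma rhoAt_le {N : X → ℝ} (hN : IsEquivNorm N) {t K : ℝ} (ht : 0 < t) (hK : 0 ≤ K)
    {x : X} (hx : N x = 1)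
    (Z : Subspace ℝ X) (hZ : FinCodim Z) (h : ∀ z ∈ Z, N z = 1 → N (x + t • z) - 1 ≤ K) :
    rhoAtNorm N t x ≤ K := by
  refine (csInf_le (rhoAt_bddBelow hN ht hx) ⟨Z, hZ, rfl⟩).trans ?_
  apply Real.sSup_le _ hK
  rintro r ⟨z, hz, hz1, rfl⟩
  exact h z hz hz1

lemma aus_of_filter {N : X → ℝ} (hN : IsEquivNorm N)
    (h : ∀ ε > 0, ∃ σ > 0, ∀ x, N x = 1 → ∀ᶠ w in fcf X, N w ≤ σ → N (x + w) ≤ 1 + ε * σ) :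
    AUSNorm N := by
  rw [AUSNorm, Metric.tendsto_nhdsWithin_nhds]
  intro ε hε
  obtain ⟨σ, hσ, h⟩ := h (ε / 2) (by positivity)
  refine ⟨σ, hσ, fun {t} ht htσ => ?_⟩
  have ht : 0 < t := ht
  rw [Real.dist_eq, sub_zero, abs_of_pos ht] at htσ
  have h0 : 0 ≤ rhoModNorm N t := by
    apply Real.sSup_nonneg
    rintro r ⟨x, hx, rfl⟩
    exact rhoAt_nonneg hN ht hx
  have h1 : rhoModNorm N t ≤ ε / 2 * t := by
    apply Real.sSup_le _ (by positivity)
    rintro r ⟨x, hx, rfl⟩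
    obtain ⟨Z, hZ, h⟩ := ev_fcf.1 (h x hx)
    refine rhoAt_le hN ht (by positivity) hx Z hZ (fun z hz hz1 => ?_)
    have h2 := h (σ • z) (Z.smul_mem _ hz) (by rw [hN.smul_nn hσ.le, hz1, mul_one])
    have := seg_upper hN hx.le ht.le htσ.le hσ h2
    linarith
  rw [Real.dist_eq, sub_zero, abs_of_nonneg (by positivity), div_lt_iff₀ ht]
  have : 0 < ε * t := by positivity
  linarith

lemma filter_of_aus {N : X → ℝ} (hN : IsEquivNorm N) (h : AUSNorm N) :
    ∀ ε > 0, ∃ σ > 0, ∀ s, 0 < s → s ≤ σ →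
      ∀ x, N x = 1 → ∀ᶠ w in fcf X, N w ≤ s → N (x + w) ≤ 1 + ε * s := by
  intro ε hε
  rw [AUSNorm, Metric.tendsto_nhdsWithin_nhds] at h
  obtain ⟨σ, hσ, h⟩ := h ε hε
  refine ⟨σ / 2, by positivity, fun s hs hsσ x hx => ?_⟩
  have h1 := h (x := s) hs (by rw [Real.dist_eq, sub_zero, abs_of_pos hs]; linarith)
  rw [Real.dist_eq, sub_zero] at h1
  have h1 := (abs_lt.1 h1).2
  rw [div_lt_iff₀ hs] at h1
  have h2 : rhoAtNorm N s x ≤ rhoModNorm N s := by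
    refine le_csSup ⟨s, ?_⟩ ⟨x, hx, rfl⟩
    rintro r ⟨y, hy, rfl⟩
    refine rhoAt_le hN hs hs.le hy ⊤ FinCodim.top (fun z hz hz1 => ?_)
    exact (rho_set_bdd hN hs hy ⊤ _ ⟨z, hz, hz1, rfl⟩).1
  obtain ⟨q, ⟨Z, hZ, rfl⟩, hq⟩ := exists_lt_of_csInf_lt
    (by exact ⟨_, ⊤, FinCodim.top, rfl⟩) (h2.trans_lt h1)
  refine ev_fcf.2 ⟨Z, hZ, fun w hw hws => ?_⟩
  by_cases hw0 : w = 0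
  · subst hw0
    rw [add_zero, hx]
    have : 0 < ε * s := by positivity
    linarith
  have hp := hN.pos hw0
  have hz1 : N ((N w)⁻¹ • w) = 1 := by
    rw [hN.smul_nn (inv_nonneg.2 hp.le), inv_mul_cancel₀ hp.ne']
  have h3 := le_csSup ⟨s, fun r hr => (rho_set_bdd hN hs hx Z r hr).1⟩
    ⟨(N w)⁻¹ • w, Z.smul_mem _ hw, hz1, rfl⟩
  have h4 := seg_upper hN (K := ε) hx.le hp.le hws hs (w := (N w)⁻¹ • w) (by linarith)
  rw [smul_smul, mul_inv_cancel₀ hp.ne', one_smul] at h4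
  have : ε * N w ≤ ε * s := by gcongr
  linarith

lemma del_inf_bdd (hX : ¬ FiniteDimensional ℝ X) {N : X → ℝ} (hN : IsEquivNorm N) {t : ℝ}
    (ht : 0 < t) {x : X} (hx : N x = 1) {Z : Subspace ℝ X} (hZ : FinCodim Z) :
    sInf {r | ∃ z ∈ Z, N z = 1 ∧ r = N (x + t • z) - 1} ≤ t ∧
    -1 ≤ sInf {r | ∃ z ∈ Z, N z = 1 ∧ r = N (x + t • z) - 1} := by
  obtain ⟨z, hz, hz1⟩ := exists_unit hX hN hZ
  have hb : BddBelow {r | ∃ z ∈ Z, N z = 1 ∧ r = N (x + t • z) - 1} :=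
    ⟨-1, fun r hr => (rho_set_bdd hN ht hx Z r hr).2⟩
  refine ⟨(csInf_le hb ⟨z, hz, hz1, rfl⟩).trans (rho_set_bdd hN ht hx Z _ ⟨z, hz, hz1, rfl⟩).1, ?_⟩
  exact le_csInf ⟨_, z, hz, hz1, rfl⟩ (fun r hr => (rho_set_bdd hN ht hx Z r hr).2)

lemma del_bddAbove (hX : ¬ FiniteDimensional ℝ X) {N : X → ℝ} (hN : IsEquivNorm N) {t : ℝ}
    (ht : 0 < t) {x : X} (hx : N x = 1) : BddAbove {s | ∃ Z : Subspace ℝ X, FinCodim Z ∧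
    s = sInf {r | ∃ z ∈ Z, N z = 1 ∧ r = N (x + t • z) - 1}} := by
  refine ⟨t, ?_⟩
  rintro s ⟨Z, hZ, rfl⟩
  exact (del_inf_bdd hX hN ht hx hZ).1

lemma auc_of_filter (hX : ¬ FiniteDimensional ℝ X) {N : X → ℝ} (hN : IsEquivNorm N)
    (h : ∀ t > 0, ∃ δ > 0, ∀ x, N x = 1 → ∀ᶠ w in fcf X, N w = t → 1 + δ ≤ N (x + w)) :
    AUCNorm N := by
  intro t ht
  obtain ⟨δ, hδ, h⟩ := h t ht
  obtain ⟨x0, -, hx0⟩ := exists_unit hX hN (FinCodim.top (X := X))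
  refine hδ.trans_le (le_csInf ⟨_, x0, hx0, rfl⟩ ?_)
  rintro r ⟨x, hx, rfl⟩
  obtain ⟨Z, hZ, h⟩ := ev_fcf.1 (h x hx)
  refine le_trans ?_ (le_csSup (del_bddAbove hX hN ht hx) ⟨Z, hZ, rfl⟩)
  obtain ⟨z, hz, hz1⟩ := exists_unit hX hN hZ
  refine le_csInf ⟨_, z, hz, hz1, rfl⟩ ?_
  rintro r ⟨z, hz, hz1, rfl⟩
  have := h (t • z) (Z.smul_mem _ hz) (by rw [hN.smul_nn ht.le, hz1, mul_one])
  linarith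

lemma filter_of_auc (hX : ¬ FiniteDimensional ℝ X) {N : X → ℝ} (hN : IsEquivNorm N)
    (h : AUCNorm N) :
    ∀ t > 0, ∃ δ > 0, ∀ x, N x = 1 → ∀ᶠ w in fcf X, t ≤ N w → 1 + δ ≤ N (x + w) := by
  intro t ht
  have hd := h t ht
  refine ⟨deltaModNorm N t / 2, by positivity, fun x hx => ?_⟩
  have h1 : deltaModNorm N t ≤ deltaAtNorm N t x := by
    refine csInf_le ⟨-1, ?_⟩ ⟨x, hx, rfl⟩
    rintro r ⟨y, hy, rfl⟩
    exact (del_inf_bdd hX hN ht hy FinCodim.top).2.trans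
      (le_csSup (del_bddAbove hX hN ht hy) ⟨⊤, FinCodim.top, rfl⟩)
  obtain ⟨q, ⟨Z, hZ, rfl⟩, hq⟩ := exists_lt_of_lt_csSup
    (by exact ⟨_, ⊤, FinCodim.top, rfl⟩) (lt_of_lt_of_le (half_lt_self hd) h1)
  refine ev_fcf.2 ⟨Z, hZ, fun w hw htw => ?_⟩
  set δ := deltaModNorm N t / 2
  have hp : 0 < N w := ht.trans_le htw
  have hz1 : N ((N w)⁻¹ • w) = 1 := by
    rw [hN.smul_nn (inv_nonneg.2 hp.le), inv_mul_cancel₀ hp.ne']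
  have h3 := csInf_le ⟨-1, fun r hr => (rho_set_bdd hN ht hx Z r hr).2⟩
    ⟨(N w)⁻¹ • w, Z.smul_mem _ hw, hz1, rfl⟩
  by_contra hcon
  push Not at hcon
  have h4 := seg_upper hN (K := δ / N w) hx.le ht.le htw hp (w := (N w)⁻¹ • w) (by
    rw [smul_smul, mul_inv_cancel₀ hp.ne', one_smul, div_mul_cancel₀ _ hp.ne']
    exact hcon.le)
  have : δ / N w * t ≤ δ := by
    rw [div_mul_eq_mul_div, div_le_iff₀ hp]
    have : 0 < δ := by positivity
    gcongr
  linarith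

lemma beta_auc (hX : ¬ FiniteDimensional ℝ X) {N : X → ℝ} (hN : IsEquivNorm N)
    (h : NormHasPropertyBeta N) : AUCNorm N := by
  apply auc_of_filter hX hN
  intro t ht
  obtain ⟨a, ha1, -, h⟩ := h
  obtain ⟨δ, hδ, h⟩ := h (min t 1 / 2) (by positivity) (by
    have := min_le_right t 1
    linarith)
  set δ' := min 1 δ with hδ'
  have hd0 : 0 < δ' := by positivity
  have hd1 : δ' ≤ 1 := min_le_left _ _
  have hd2 : δ' ≤ δ := min_le_right _ _
  refine ⟨δ', hd0, fun x hx => ?_⟩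
  by_contra hcon
  obtain ⟨f, hf, hfN⟩ := hN.exists_norming x
  have h1 : ∃ᶠ w in fcf X, N w = t ∧ N (x + w) < 1 + δ' := by
    intro h'
    apply hcon
    filter_upwards [h'] with w hw hwt
    by_contra h''
    exact hw ⟨hwt, not_le.1 h''⟩
  obtain ⟨u, hu, hsep⟩ := exists_seq hN (h1.and_eventually (ev_ker f))
  have hk : (0 : ℝ) ≤ (1 + δ')⁻¹ := by positivity
  have hk2 : (1 / 2 : ℝ) ≤ (1 + δ')⁻¹ := by
    rw [one_div]
    apply inv_anti₀ <;> linarith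
  have hsep2 : ∀ m n, m < n → min t 1 / 2 ≤ N ((1 + δ')⁻¹ • (x + u m) - (1 + δ')⁻¹ • (x + u n)) := by
    intro m n hmn
    rw [← smul_sub, hN.smul_nn hk, add_sub_add_left_eq_sub]
    have h2 := hsep m n hmn
    rw [(hu m).1.1] at h2
    have h3 : (1 / 2) * t ≤ (1 + δ')⁻¹ * N (u m - u n) := mul_le_mul hk2 h2 ht.le hk
    have := min_le_left t 1
    linarith
  obtain ⟨n, hn⟩ := h (-x) (by rw [hN.neg, hx]) (fun n => (1 + δ')⁻¹ • (x + u n)) (fun n => by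
    rw [hN.smul_nn hk, inv_mul_le_one₀ (by positivity)]
    exact (hu n).1.2.le) (fun m n hmn => by
      rcases lt_or_gt_of_ne hmn with h' | h'
      · exact hsep2 m n h'
      · rw [hN.sub_comm]
        exact hsep2 n m h')
  have h5 := hfN (-(-x - (1 + δ')⁻¹ • (x + u n)))
  rw [hN.neg] at h5
  have h6 : f (-(-x - (1 + δ')⁻¹ • (x + u n))) = 1 + (1 + δ')⁻¹ := by
    simp [hf, hx, (hu n).2]
    ring
  rw [h6] at h5
  have h7 : 1 - δ' ≤ (1 + δ')⁻¹ := by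
    rw [← one_div, le_div_iff₀ (by positivity)]
    nlinarith
  linarith

lemma beta_game {N : X → ℝ} (hN : IsEquivNorm N)
    (h : NormHasPropertyBeta N) : ∃ θ : ℝ, 3 / 4 ≤ θ ∧ θ < 1 ∧ ∀ s, 0 < s → ∀ x, N x ≤ s →
      ∀ᶠ w in fcf X, N w ≤ s → N (x + w) ≤ 2 * θ * s := by
  obtain ⟨a, ha1, -, h⟩ := h
  obtain ⟨δ, hδ, h⟩ := h (1 / 2) (by positivity) (by linarith)
  have key : ∀ x, N x ≤ 1 → 
      ∀ᶠ w in fcf X, N w ≤ 1 → N (x + w) ≤ 2 * (max (1 - δ) (3 / 4)) := by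
    intro x hx
    by_contra hcon
    have h1 : ∃ᶠ w in fcf X, N w ≤ 1 ∧ 2 * (max (1 - δ) (3 / 4)) < N (x + w) := by
      intro h'
      apply hcon
      filter_upwards [h'] with w hw hwt
      by_contra h''
      exact hw ⟨hwt, not_le.1 h''⟩
    obtain ⟨u, hu, hsep⟩ := exists_seq hN h1
    have hm1 := le_max_left (1 - δ) (3 / 4)
    have hm2 := le_max_right (1 - δ) (3 / 4)
    have hsep2 : ∀ m n, m < n → 1 / 2 ≤ N (- u m - - u n) := by
      intro m n hmn
      have h2 := hsep m n hmn
      have h3 := (hu m).2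
      have h4 := hN.add_le x (u m)
      have h5 : - u m - - u n = - (u m - u n) := by abel
      rw [h5, hN.neg]
      linarith
    obtain ⟨n, hn⟩ := h x hx (fun n => - u n) (fun n => by rw [hN.neg]; exact (hu n).1)
      (fun m n hmn => by
      rcases lt_or_gt_of_ne hmn with h' | h'
      · exact hsep2 m n h'
      · rw [hN.sub_comm]
        exact hsep2 n m h')
    have := (hu n).2
    rw [sub_neg_eq_add] at hn
    linarith
  refine ⟨max (1 - δ) (3 / 4), le_max_right _ _, by apply max_lt <;> linarith, fun s hs x hx => ?_⟩
  filter_upwards [ev_smul (key (s⁻¹ • x) (by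
    rw [hN.smul_nn (by positivity), inv_mul_le_one₀ hs]; exact hx)) s⁻¹] with w hw hws
  have := hw (by rw [hN.smul_nn (by positivity), inv_mul_le_one₀ hs]; exact hws)
  rw [← smul_add, hN.smul_nn (by positivity), inv_mul_le_iff₀ hs] at this
  linarith

lemma helly {N : X → ℝ} (hN : IsEquivNorm N) (φ : StrongDual ℝ (StrongDual ℝ X))
    (hφ : ∀ f : StrongDual ℝ X, (∀ y, f y ≤ N y) → φ f ≤ 1) (T : Finset (StrongDual ℝ X))
    {ε : ℝ} (hε : 0 < ε) : ∃ x, N x ≤ 1 ∧ ∀ f ∈ T, |f x - φ f| < ε := by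
  classical
  let e : X →ₗ[ℝ] (T → ℝ) := LinearMap.pi (fun f => ((f : StrongDual ℝ X) : X →ₗ[ℝ] ℝ))
  let v : T → ℝ := fun f => φ f
  have hconv : Convex ℝ {x | N x ≤ 1} := by
    intro x hx y hy a b ha hb hab
    have h1 := hN.conv ha hb x y
    have hx : N x ≤ 1 := hx
    have hy : N y ≤ 1 := hy
    show N _ ≤ 1
    nlinarith
  have hA : Convex ℝ (e '' {x | N x ≤ 1}) := hconv.linear_image e
  have hv : v ∈ closure (e '' {x | N x ≤ 1}) := by
    by_contra hv
    obtain ⟨L, u, hL1, hL2⟩ := geometric_hahn_banach_closed_point hA.closure isClosed_closure hv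
    have hL : ∀ a : T → ℝ, L a = ∑ i, a i * L (Pi.single i 1) := by
      intro a
      conv_lhs => rw [pi_eq_sum_univ' a]
      rw [map_sum]
      refine Finset.sum_congr rfl (fun i _ => ?_)
      rw [← smul_eq_mul, ← map_smul]
    let g : StrongDual ℝ X := ∑ i : T, (L (Pi.single i 1)) • (i : StrongDual ℝ X)
    have hg : ∀ x, g x = L (e x) := by
      intro x
      rw [hL]
      simp [g, e, mul_comm]
    have hgφ : φ g = L v := by
      rw [hL]
      simp [g, v, mul_comm]
    have hle : ∀ x, N x ≤ 1 → g x < u := fun x hx => by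
      rw [hg]
      exact hL1 _ (subset_closure ⟨x, hx, rfl⟩)
    have hu : 0 < u := by
      have := hle 0 (by rw [hN.zero]; norm_num)
      simpa using this
    have := hφ (u⁻¹ • g) (fun y => by
      by_cases hy : y = 0
      · subst hy; simp [hN.zero]
      have hp := hN.pos hy
      have h1 := hle ((N y)⁻¹ • y) (by
        rw [hN.smul_nn (by positivity), inv_mul_cancel₀ hp.ne'])
      rw [map_smul, smul_eq_mul, inv_mul_lt_iff₀ hp] at h1
      rw [smul_apply, smul_eq_mul, inv_mul_le_iff₀ hu]
      linarith)
    rw [map_smul, smul_eq_mul, inv_mul_le_one₀ hu, hgφ] at this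
    linarith
  obtain ⟨_, ⟨x, hx, rfl⟩, hd⟩ := Metric.mem_closure_iff.1 hv ε hε
  refine ⟨x, hx, fun f hf => ?_⟩
  have := (dist_pi_lt_iff hε).1 hd ⟨f, hf⟩
  rw [dist_comm, Real.dist_eq] at this
  exact this

lemma beta_refl_aux {N : X → ℝ} (hN : IsEquivNorm N) (h : NormHasPropertyBeta N)
    (φ : StrongDual ℝ (StrongDual ℝ X))
    (hφ : ∀ f : StrongDual ℝ X, (∀ y, f y ≤ N y) → φ f ≤ 1)
    (hφ' : ∀ ε > 0, ∃ f : StrongDual ℝ X, (∀ y, f y ≤ N y) ∧ 1 - ε < φ f)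
    {t : ℝ} (ht : 0 < t) (ht1 : t ≤ 1) :
    ∃ y, ∀ f : StrongDual ℝ X, (∀ y, f y ≤ N y) → |φ f - f y| ≤ 2 * t := by
  obtain ⟨a, ha1, -, h⟩ := h
  obtain ⟨δ, hδ, h⟩ := h t ht (by linarith)
  obtain ⟨f0, hf0, hf0δ⟩ := hφ' δ hδ
  have hcov : ∃ F : Finset X, ∀ x, N x ≤ 1 → 1 - δ < f0 x → ∃ y ∈ F, N (x - y) < t := by
    by_contra hcon
    push Not at hcon
    obtain ⟨u, hu, hsep⟩ := exists_seq_of_forall_finset_exists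
      (fun x => N x ≤ 1 ∧ 1 - δ < f0 x) (fun y x => t ≤ N (x - y)) (fun s _ => by
        obtain ⟨x, hx1, hx2, hx3⟩ := hcon s
        exact ⟨x, ⟨hx1, hx2⟩, hx3⟩)
    obtain ⟨n, hn⟩ := h (-(u 0)) (by rw [hN.neg]; exact (hu 0).1) u (fun n => (hu n).1)
      (fun m n hmn => by
      rcases lt_or_gt_of_ne hmn with h' | h'
      · rw [hN.sub_comm]
        exact hsep m n h'
      · exact hsep n m h')
    have h1 := hf0 (-(-(u 0) - u n))
    rw [hN.neg] at h1
    have h2 : f0 (-(-(u 0) - u n)) = f0 (u 0) + f0 (u n) := by simp; ring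
    have := (hu 0).2
    have := (hu n).2
    linarith
  obtain ⟨F, hF⟩ := hcov
  by_contra hcon
  push Not at hcon
  choose g hg1 hg2 using hcon
  classical
  obtain ⟨x, hx, hxf⟩ := helly hN φ hφ (insert f0 (F.image g))
    (ε := min t (φ f0 - (1 - δ))) (lt_min ht (by linarith))
  have h0 := hxf f0 (Finset.mem_insert_self _ _)
  have h0 := (abs_lt.1 (h0.trans_le (min_le_right _ _))).1
  obtain ⟨y, hy, hxy⟩ := hF x hx (by linarith)
  have h1 := hxf (g y) (Finset.mem_insert_of_mem (Finset.mem_image_of_mem g hy))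
  have h1 := abs_lt.1 (h1.trans_le (min_le_left _ _))
  have h2 := (hN.abs_le_of_le (hg1 y) (x - y)).trans_lt hxy
  rw [map_sub, abs_lt] at h2
  have h3 := hg2 y
  have : |φ (g y) - g y y| ≤ 2 * t := by
    rw [abs_le]; constructor <;> linarith
  linarith

lemma beta_refl [CompleteSpace X] {N : X → ℝ} (hN : IsEquivNorm N) (h : NormHasPropertyBeta N) :
    Function.Surjective (NormedSpace.inclusionInDoubleDual ℝ X) := by
  obtain ⟨c, hc, C, hC, hb⟩ := id hN.2.2
  -- every functional is a multiple of one dominated by N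
  have hscale : ∀ f : StrongDual ℝ X, f ≠ 0 → ∀ y, (c * ‖f‖⁻¹) • f y ≤ N y := by
    intro f hf y
    have h1 : f y ≤ ‖f‖ * ‖y‖ := (le_abs_self _).trans (f.le_opNorm y)
    have hp : 0 < ‖f‖ := norm_pos_iff.2 hf
    refine le_trans ?_ (hb y).1
    rw [smul_eq_mul, mul_assoc]
    refine mul_le_mul_of_nonneg_left ?_ hc.le
    rwa [inv_mul_le_iff₀ hp]
  have norm1 : ∀ φ : StrongDual ℝ (StrongDual ℝ X),
      (∀ f : StrongDual ℝ X, (∀ y, f y ≤ N y) → φ f ≤ 1) →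
      (∀ ε > 0, ∃ f : StrongDual ℝ X, (∀ y, f y ≤ N y) ∧ 1 - ε < φ f) →
      φ ∈ Set.range (NormedSpace.inclusionInDoubleDual ℝ X) := by
    intro φ h1 h2
    have hcl : IsClosed (Set.range (NormedSpace.inclusionInDoubleDual ℝ X)) :=
      have hiso : Isometry (NormedSpace.inclusionInDoubleDualLi (E := X) ℝ) :=
        (NormedSpace.inclusionInDoubleDualLi (E := X) ℝ).isometry
      hiso.isClosedEmbedding.isClosed_range
    rw [← hcl.closure_eq]
    refine (Metric.mem_closure_iff (α := StrongDual ℝ (StrongDual ℝ X))).2 ?_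
    intro ε hε
    obtain ⟨y, hy⟩ := beta_refl_aux hN h φ h1 h2 (t := min 1 (c * ε / 4)) (by positivity)
      (min_le_left _ _)
    refine ⟨_, ⟨y, rfl⟩, ?_⟩
    refine (dist_eq_norm (E := StrongDual ℝ (StrongDual ℝ X)) _ _).trans_lt ?_
    refine lt_of_le_of_lt (ContinuousLinearMap.opNorm_le_bound _ (M := ε / 2) (by positivity)
      (fun f => ?_)) (half_lt_self hε)
    by_cases hf : f = 0
    · subst hf; simp
    have hp : 0 < ‖f‖ := norm_pos_iff.2 hf
    have h3 := hy ((c * ‖f‖⁻¹) • f) (fun y => hscale f hf y)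
    rw [map_smul, smul_apply, ← smul_sub, smul_eq_mul, abs_mul,
      abs_of_pos (by positivity : 0 < c * ‖f‖⁻¹)] at h3
    rw [sub_apply, NormedSpace.dual_def, Real.norm_eq_abs]
    have h4 : min 1 (c * ε / 4) ≤ c * ε / 4 := min_le_right _ _
    have h5 : c * ‖f‖⁻¹ * |φ f - f y| ≤ c * (ε / 2) := by linarith
    rw [mul_assoc] at h5
    have h6 := le_of_mul_le_mul_left h5 hc
    rw [inv_mul_le_iff₀ hp] at h6
    linarith
  intro φ
  by_cases hφ : φ = 0
  · exact ⟨0, by rw [hφ, map_zero]⟩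
  obtain ⟨f, hf⟩ : ∃ f, φ f ≠ 0 := by
    by_contra hcon
    push Not at hcon
    exact hφ (ContinuousLinearMap.ext hcon)
  obtain ⟨f, hf⟩ : ∃ f, 0 < φ f := by
    rcases lt_or_gt_of_ne hf with h' | h'
    · exact ⟨-f, by rw [map_neg]; linarith⟩
    · exact ⟨f, h'⟩
  have hf0 : f ≠ 0 := by rintro rfl; simp at hf
  let S : Set ℝ := {r | ∃ g : StrongDual ℝ X, (∀ y, g y ≤ N y) ∧ r = φ g}
  have hS : BddAbove S := by
    refine ⟨‖φ‖ * C, ?_⟩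
    rintro r ⟨g, hg, rfl⟩
    refine (le_abs_self _).trans ((φ.le_opNorm g).trans ?_)
    refine mul_le_mul_of_nonneg_left ?_ (norm_nonneg _)
    refine ContinuousLinearMap.opNorm_le_bound _ hC.le (fun y => ?_)
    exact (hN.abs_le_of_le hg y).trans (hb y).2
  have hM : 0 < sSup S := by
    have hp : 0 < ‖f‖ := norm_pos_iff.2 hf0
    refine lt_of_lt_of_le ?_ (le_csSup hS ⟨(c * ‖f‖⁻¹) • f, fun y => hscale f hf0 y, rfl⟩)
    rw [map_smul, smul_eq_mul]
    positivity
  obtain ⟨y, hy⟩ := norm1 ((sSup S)⁻¹ • φ) (fun g hg => by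
    rw [smul_apply, smul_eq_mul, inv_mul_le_one₀ hM]
    exact le_csSup hS ⟨g, hg, rfl⟩) (fun ε hε => by
    obtain ⟨_, ⟨g, hg, rfl⟩, hlt⟩ := exists_lt_of_lt_csSup (s := S) ⟨φ 0, 0, fun y => by
      simpa using hN.nonneg y, rfl⟩ (b := sSup S * (1 - ε)) (by nlinarith)
    refine ⟨g, hg, ?_⟩
    rw [smul_apply, smul_eq_mul, lt_inv_mul_iff₀ hM]
    exact hlt)
  refine ⟨(sSup S) • y, ?_⟩
  rw [map_smul, hy, smul_smul, mul_inv_cancel₀ hM.ne', one_smul]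

/-- admissible convex functions relative to `N` -/
structure Adm (N : X → ℝ) (g : X → ℝ) : Prop where
  lip : ∀ x y, g x ≤ g y + N (x - y)
  conv : ∀ (x y : X) (a b : ℝ), 0 ≤ a → 0 ≤ b → a + b = 1 → g (a • x + b • y) ≤ a * g x + b * g y
  even : ∀ x, g (-x) = g x
  ge : ∀ x, N x ≤ g x

/-- one-step upper value of the asymptotic game -/
def Vop (N : X → ℝ) (s : ℝ) (g : X → ℝ) (x : X) : ℝ :=
  sInf {c | ∀ᶠ w in fcf X, N w ≤ s → g (x + w) ≤ c}

lemma Vset_lb {N : X → ℝ} (hN : IsEquivNorm N) {s : ℝ} (hs : 0 ≤ s) {g : X → ℝ} (x : X) :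
    ∀ c ∈ {c | ∀ᶠ w in fcf X, N w ≤ s → g (x + w) ≤ c}, g x ≤ c := by
  intro c hc
  have := ev_zero hc (by rw [hN.zero]; exact hs)
  rwa [add_zero] at this

lemma V_le {N : X → ℝ} (hN : IsEquivNorm N) {s : ℝ} (hs : 0 ≤ s) {g : X → ℝ} {x : X} {c : ℝ}
    (h : ∀ᶠ w in fcf X, N w ≤ s → g (x + w) ≤ c) : Vop N s g x ≤ c :=
  csInf_le ⟨g x, fun c hc => Vset_lb hN hs x c hc⟩ h

lemma V_nonempty {N : X → ℝ} {s : ℝ} {g : X → ℝ} (hg : Adm N g) (x : X) :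
    {c | ∀ᶠ w in fcf X, N w ≤ s → g (x + w) ≤ c}.Nonempty := by
  refine ⟨g x + s, ?_⟩
  show ∀ᶠ w in fcf X, N w ≤ s → g (x + w) ≤ g x + s
  refine Eventually.of_forall fun w hw => ?_
  have := hg.lip (x + w) x
  rw [add_sub_cancel_left] at this
  linarith

lemma V_ev {N : X → ℝ} {s : ℝ} {g : X → ℝ} (hg : Adm N g) {x : X} {c : ℝ}
    (h : Vop N s g x < c) : ∀ᶠ w in fcf X, N w ≤ s → g (x + w) ≤ c := by
  obtain ⟨c', hc', hlt⟩ := exists_lt_of_csInf_lt (V_nonempty hg x) h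
  filter_upwards [hc'] with w hw hws
  exact (hw hws).trans hlt.le

lemma le_V {N : X → ℝ} (hN : IsEquivNorm N) {s : ℝ} (hs : 0 ≤ s) {g : X → ℝ} (hg : Adm N g)
    (x : X) : g x ≤ Vop N s g x :=
  le_csInf (V_nonempty hg x) (Vset_lb hN hs x)

lemma V_mono {N : X → ℝ} (hN : IsEquivNorm N) {s : ℝ} (hs : 0 ≤ s) {g g' : X → ℝ}
    (hg' : Adm N g') (h : ∀ x, g x ≤ g' x) (x : X) : Vop N s g x ≤ Vop N s g' x := by
  apply le_of_forall_gt
  intro c hc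
  obtain ⟨c', h1, h2⟩ := exists_between hc
  refine lt_of_le_of_lt (V_le hN hs ?_) h2
  filter_upwards [V_ev hg' h1] with w hw hws
  exact (h _).trans (hw hws)

lemma Adm.self {N : X → ℝ} (hN : IsEquivNorm N) : Adm N N where
  lip x y := by linarith [hN.le_sub x y]
  conv x y a b ha hb _ := hN.conv ha hb x y
  even := hN.neg
  ge _ := le_rfl

lemma Adm.V {N : X → ℝ} (hN : IsEquivNorm N) {s : ℝ} (hs : 0 ≤ s) {g : X → ℝ} (hg : Adm N g) :
    Adm N (Vop N s g) where
  lip x y := by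
    rw [← sub_le_iff_le_add]
    apply le_of_forall_gt
    intro c hc
    obtain ⟨c', h1, h2⟩ := exists_between hc
    have : Vop N s g x ≤ c' + N (x - y) := by
      apply V_le hN hs
      filter_upwards [V_ev hg h1] with w hw hws
      have h3 := hg.lip (x + w) (y + w)
      rw [add_sub_add_right_eq_sub] at h3
      linarith [hw hws]
    linarith
  conv x y a b ha hb hab := by
    apply le_of_forall_pos_le_add
    intro ε hε
    apply V_le hN hs
    filter_upwards [V_ev hg (lt_add_of_pos_right (Vop N s g x) hε),
      V_ev hg (lt_add_of_pos_right (Vop N s g y) hε)] with w h1 h2 hws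
    have h3 : a • x + b • y + w = a • (x + w) + b • (y + w) := by
      conv_lhs => rw [← one_smul ℝ w, ← hab]
      module
    rw [h3]
    refine (hg.conv _ _ a b ha hb hab).trans ?_
    have := mul_le_mul_of_nonneg_left (h1 hws) ha
    have := mul_le_mul_of_nonneg_left (h2 hws) hb
    nlinarith
  even := by
    have key : ∀ x, Vop N s g (-x) ≤ Vop N s g x := by
      intro x
      apply le_of_forall_gt
      intro c hc
      obtain ⟨c', h1, h2⟩ := exists_between hc
      refine lt_of_le_of_lt (V_le hN hs ?_) h2
      filter_upwards [ev_smul (V_ev hg h1) (-1)] with w hw hws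
      rw [neg_smul, one_smul, hN.neg] at hw
      have := hw hws
      rwa [← hg.even, neg_add, neg_neg] at this
    intro x
    apply le_antisymm (key x)
    have := key (-x)
    rwa [neg_neg] at this
  ge x := (hg.ge x).trans (le_V hN hs hg x)

lemma Adm.iter {N : X → ℝ} (hN : IsEquivNorm N) {s : ℝ} (hs : 0 ≤ s) {g : X → ℝ} (hg : Adm N g)
    (n : ℕ) : Adm N ((Vop N s)^[n] g) := by
  induction n with
  | zero => simpa using hg
  | succ n ih =>
    rw [Function.iterate_succ_apply']
    exact ih.V hN hs

lemma V_two {N : X → ℝ} (hN : IsEquivNorm N) {θ : ℝ} (hθ : 0 ≤ θ)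
    (hgame : ∀ s, 0 < s → ∀ x, N x ≤ s →
      ∀ᶠ w in fcf X, N w ≤ s → N (x + w) ≤ 2 * θ * s) {s : ℝ} (hs : 0 < s) {g : X → ℝ}
    (hg : Adm N g) (x : X) :
    Vop N s (Vop N s g) x ≤ Vop N (2 * θ * s) g x := by
  apply le_of_forall_gt
  intro c hc
  obtain ⟨c', h1, h2⟩ := exists_between hc
  refine lt_of_le_of_lt (V_le hN hs.le ?_) h2
  obtain ⟨Z, hZ, hZ'⟩ := ev_fcf.1 (V_ev hg h1)
  refine ev_fcf.2 ⟨Z, hZ, fun w hw hws => V_le hN hs.le ?_⟩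
  have hZm : ∀ᶠ v in fcf X, v ∈ Z := ev_fcf.2 ⟨Z, hZ, fun _ hv => hv⟩
  filter_upwards [hZm, hgame s hs w hws] with v hv hv2 hvs
  rw [add_assoc]
  exact hZ' _ (Z.add_mem hw hv) (hv2 hvs)

lemma V_pow {N : X → ℝ} (hN : IsEquivNorm N) {θ : ℝ} (hθ : 0 < θ)
    (hgame : ∀ s, 0 < s → ∀ x, N x ≤ s →
      ∀ᶠ w in fcf X, N w ≤ s → N (x + w) ≤ 2 * θ * s) {s : ℝ} (hs : 0 < s) (m : ℕ) :
    ∀ {g : X → ℝ}, Adm N g → ∀ x, (Vop N s)^[2 ^ m] g x ≤ Vop N ((2 * θ) ^ m * s) g x := by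
  induction m with
  | zero => intro g _ x; simp
  | succ m ih =>
    intro g hg x
    rw [pow_succ, mul_two, Function.iterate_add_apply]
    have hτ : 0 < (2 * θ) ^ m * s := by positivity
    refine (ih (hg.iter hN hs.le _) x).trans ?_
    refine (V_mono hN hτ.le (hg.V hN hτ.le) (ih hg) x).trans ?_
    refine (V_two hN hθ.le hgame hτ hg x).trans (le_of_eq ?_)
    congr 1
    ring

lemma exists_level {N : X → ℝ} (hN : IsEquivNorm N) {θ : ℝ} (hθ : 0 < θ) (hθ1 : θ < 1)
    (hgame : ∀ s, 0 < s → ∀ x, N x ≤ s →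
      ∀ᶠ w in fcf X, N w ≤ s → N (x + w) ≤ 2 * θ * s) (m : ℕ) :
    ∃ A : X → ℝ, Adm N A ∧ (∀ x, A x ≤ N x + 1) ∧ ∀ x, ∀ᶠ w in fcf X, N w ≤ (1 / 2) ^ m →
      A (x + w) ≤ A x + 2 * ((1 / 2) ^ m * θ ^ m) := by
  set s : ℝ := (1 / 2) ^ m with hs_def
  have hs : 0 < s := by positivity
  set G : ℕ → X → ℝ := fun i => (Vop N s)^[i] N with hG
  have hGadm : ∀ i, Adm N (G i) := fun i => (Adm.self hN).iter hN hs.le i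
  have hGsucc : ∀ i x, G (i + 1) x = Vop N s (G i) x := by
    intro i x
    simp only [hG]
    rw [Function.iterate_succ_apply']
  have hGmono : ∀ x, Monotone (fun i => G i x) := fun x =>
    monotone_nat_of_le_succ (fun i => by rw [hGsucc]; exact le_V hN hs.le (hGadm i) x)
  have hpow0 : 0 < θ ^ m := by positivity
  have hpow1 : θ ^ m ≤ 1 := pow_le_one₀ hθ.le hθ1.le
  have hG0 : G (2 ^ m) 0 ≤ θ ^ m := by
    refine (V_pow hN hθ hgame hs m (Adm.self hN) 0).trans ?_
    apply V_le hN (by positivity)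
    refine Eventually.of_forall fun w hw => ?_
    rw [zero_add]
    refine hw.trans (le_of_eq ?_)
    rw [hs_def, ← mul_pow]
    congr 1
    ring
  have hGx : ∀ x, G (2 ^ m) x ≤ N x + θ ^ m := by
    intro x
    have := (hGadm (2 ^ m)).lip x 0
    rw [sub_zero] at this
    linarith
  have hk : (0 : ℝ) < 2 ^ m := by positivity
  have hsk : s * 2 ^ m = 1 := by rw [hs_def, ← mul_pow]; norm_num
  set A : X → ℝ := fun x => s * ∑ i ∈ Finset.range (2 ^ m), G i x with hA
  have hcard : ∀ r : ℝ, s * ∑ i ∈ Finset.range (2 ^ m), r = r := by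
    intro r
    rw [Finset.sum_const, Finset.card_range, nsmul_eq_mul, ← mul_assoc]
    push_cast
    rw [hsk, one_mul]
  refine ⟨A, ⟨?_, ?_, ?_, ?_⟩, ?_, ?_⟩
  · intro x y
    rw [← hcard (N (x - y))]
    simp only [hA]
    rw [← mul_add, ← Finset.sum_add_distrib]
    gcongr with i hi
    exact (hGadm i).lip x y
  · intro x y a b ha hb hab
    have : a * A x + b * A y = s * ∑ i ∈ Finset.range (2 ^ m), (a * G i x + b * G i y) := by
      rw [Finset.sum_add_distrib, ← Finset.mul_sum, ← Finset.mul_sum]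
      simp only [hA]
      ring
    rw [this]
    simp only [hA]
    gcongr with i hi
    exact (hGadm i).conv x y a b ha hb hab
  · intro x
    simp only [hA, (hGadm _).even]
  · intro x
    rw [← hcard (N x)]
    simp only [hA]
    gcongr with i hi
    exact (hGadm i).ge x
  · intro x
    rw [← hcard (N x + 1)]
    simp only [hA]
    gcongr with i hi
    have := hGmono x (Finset.mem_range.1 hi).le
    simp only at this
    linarith [hGx x]
  · intro x
    have hη : 0 < s * θ ^ m := by positivity
    have hev : ∀ᶠ w in fcf X, ∀ i ∈ Finset.range (2 ^ m),
        N w ≤ s → G i (x + w) ≤ G (i + 1) x + s * θ ^ m := by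
      rw [Filter.eventually_all_finset]
      intro i _
      apply V_ev (hGadm i)
      rw [hGsucc]
      linarith
    filter_upwards [hev] with w hw hws
    have h1 : A (x + w) ≤ s * ∑ i ∈ Finset.range (2 ^ m), (G (i + 1) x + s * θ ^ m) := by
      simp only [hA]
      gcongr with i hi
      exact hw i hi hws
    rw [Finset.sum_add_distrib, mul_add, hcard] at h1
    have h2 : ∑ i ∈ Finset.range (2 ^ m), G (i + 1) x
        = ∑ i ∈ Finset.range (2 ^ m), G i x + (G (2 ^ m) x - G 0 x) := by
      have := Finset.sum_range_sub (fun i => G i x) (2 ^ m)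
      rw [← this, ← Finset.sum_add_distrib]
      exact Finset.sum_congr rfl (fun i _ => by ring)
    rw [h2, mul_add] at h1
    have h3 : G (2 ^ m) x - G 0 x ≤ θ ^ m := by
      have : G 0 x = N x := rfl
      linarith [hGx x]
    have h4 := mul_le_mul_of_nonneg_left h3 hs.le
    have h5 : A x = s * ∑ i ∈ Finset.range (2 ^ m), G i x := rfl
    linarith

def lamm (m : ℕ) : ℝ := 1 / 2 / 2 ^ m

lemma lamm_pos (m : ℕ) : 0 < lamm m := by unfold lamm; positivity

lemma lamm_sum : HasSum lamm 1 := hasSum_geometric_two' 1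

def SS (A : ℕ → X → ℝ) : Set X :=
  {x | ∃ u : ℕ → X, (∀ m, A m (u m) ≤ 2) ∧ HasSum (fun m => lamm m • u m) x}

lemma SS_big {N : X → ℝ} {A : ℕ → X → ℝ} (hA : ∀ m x, A m x ≤ N x + 1) {x : X} (hx : N x ≤ 1) :
    x ∈ SS A := by
  refine ⟨fun _ => x, fun m => by linarith [hA m x], ?_⟩
  have := lamm_sum.smul_const x
  rwa [one_smul] at this

lemma SS_small {N : X → ℝ} (hN : IsEquivNorm N) {A : ℕ → X → ℝ} (hA : ∀ m, Adm N (A m)) {x : X}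
    (hx : x ∈ SS A) : N x ≤ 2 := by
  obtain ⟨u, hu, hs⟩ := hx
  have h1 : Tendsto (fun F : Finset ℕ => N (∑ m ∈ F, lamm m • u m)) atTop (𝓝 (N x)) :=
    (hN.continuous.tendsto x).comp hs
  refine le_of_tendsto h1 (Eventually.of_forall fun F => ?_)
  have h2 : N (∑ m ∈ F, lamm m • u m) ≤ ∑ m ∈ F, lamm m * 2 := by
    induction F using Finset.induction_on with
    | empty => simp [hN.zero]
    | insert a s ha ih =>
      rw [Finset.sum_insert ha, Finset.sum_insert ha]
      refine (hN.add_le _ _).trans (add_le_add ?_ ih)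
      rw [hN.smul_nn (lamm_pos a).le]
      exact mul_le_mul_of_nonneg_left (((hA a).ge _).trans (hu a)) (lamm_pos a).le
  have h3 : ∑ m ∈ F, lamm m ≤ 1 := sum_le_hasSum F (fun i _ => (lamm_pos i).le) lamm_sum
  rw [← Finset.sum_mul] at h2
  linarith

lemma SS_convex {N : X → ℝ} {A : ℕ → X → ℝ} (hA : ∀ m, Adm N (A m)) : Convex ℝ (SS A) := by
  rintro x ⟨u, hu, hx⟩ y ⟨v, hv, hy⟩ a b ha hb hab
  refine ⟨fun m => a • u m + b • v m, fun m => ?_, ?_⟩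
  · have := (hA m).conv (u m) (v m) a b ha hb hab
    nlinarith [hu m, hv m]
  · have := (hx.const_smul a).add (hy.const_smul b)
    convert this using 2 with m
    rw [smul_add, smul_comm a, smul_comm b]

lemma SS_neg {N : X → ℝ} {A : ℕ → X → ℝ} (hA : ∀ m, Adm N (A m)) (x : X) (hx : x ∈ SS A) :
    -x ∈ SS A := by
  obtain ⟨u, hu, hx⟩ := hx
  refine ⟨fun m => - u m, fun m => by rw [(hA m).even]; exact hu m, ?_⟩
  have := hx.neg
  convert this using 2 with m
  rw [smul_neg]

/-- gauge of a convex symmetric set between two balls -/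
lemma gauge_equiv {N : X → ℝ} (hN : IsEquivNorm N) {S : Set X} (hc : Convex ℝ S)
    (hn : ∀ x ∈ S, -x ∈ S) (h1 : ∀ x, N x ≤ 1 → x ∈ S) (h2 : ∀ x ∈ S, N x ≤ 2) :
    Absorbent ℝ S ∧ IsEquivNorm (gauge S) ∧ (∀ x, gauge S x ≤ N x) ∧
      ∀ x, N x ≤ 2 * gauge S x := by
  have hab : Absorbent ℝ S := by
    apply absorbent_nhds_zero
    have : {x | N x < 1} ∈ 𝓝 (0 : X) :=
      (isOpen_lt hN.continuous continuous_const).mem_nhds (by simp [hN.zero])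
    exact mem_of_superset this fun x hx => h1 x (le_of_lt hx)
  have hle : ∀ x, gauge S x ≤ N x := by
    intro x
    apply le_of_forall_gt
    intro c hc
    obtain ⟨c', h3, h4⟩ := exists_between hc
    have hc' : 0 < c' := (hN.nonneg x).trans_lt h3
    refine lt_of_le_of_lt (gauge_le_of_mem hc'.le ?_) h4
    refine ⟨c'⁻¹ • x, h1 _ ?_, by simp [smul_smul, hc'.ne']⟩
    rw [hN.smul_nn (by positivity), inv_mul_le_iff₀ hc']
    linarith
  have hge : ∀ x, N x ≤ 2 * gauge S x := by
    intro x
    have : ∀ a, gauge S x < a → N x ≤ 2 * a := by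
      intro a ha
      obtain ⟨b, hb, hba, y, hy, rfl⟩ := exists_lt_of_gauge_lt hab ha
      simp only [hN.smul_nn hb.le]
      nlinarith [h2 y hy]
    have h' := le_of_forall_gt_imp_ge_of_dense (a₁ := N x / 2) (a₂ := gauge S x)
      (fun a ha => by linarith [this a ha])
    linarith
  refine ⟨hab, ⟨fun x y => gauge_add_le hc hab x y, ?_, ?_⟩, hle, hge⟩
  · intro a x
    rcases le_total 0 a with h | h
    · rw [gauge_smul_of_nonneg h, abs_of_nonneg h]; rfl
    · rw [abs_of_nonpos h, ← gauge_neg (fun x hx => hn x hx), ← neg_smul,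
        gauge_smul_of_nonneg (by linarith)]; rfl
  · obtain ⟨_, _, c, hc, C, hC, h⟩ := hN
    refine ⟨c / 2, by positivity, C, hC, fun x => ⟨?_, (hle x).trans (h x).2⟩⟩
    have := hge x
    have := (h x).1
    linarith

lemma SS_step {N : X → ℝ} {A : ℕ → X → ℝ} (hN : IsEquivNorm N) (hA : ∀ m, Adm N (A m))
    (hA1 : ∀ m x, A m x ≤ N x + 1) (hab : Absorbent ℝ (SS A)) {m : ℕ} {e r : ℝ} (he : 0 ≤ e)
    (hev : ∀ x, ∀ᶠ w in fcf X, N w ≤ r → A m (x + w) ≤ A m x + 2 * e)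
    {y : X} (hy : y ∈ SS A) :
    ∀ᶠ w in fcf X, N w ≤ r → gauge (SS A) (y + lamm m • w) ≤ 1 + 4 * lamm m * e := by
  obtain ⟨u, hu, hs⟩ := hy
  obtain ⟨-, hP, hle, -⟩ := gauge_equiv hN (SS_convex hA) (SS_neg hA)
    (fun x hx => SS_big hA1 hx) (fun x hx => SS_small hN hA hx)
  filter_upwards [hev (u m)] with w hw hwr
  have h1 := hw hwr
  set k : ℝ := 1 + 2 * e with hk
  have hk0 : 0 < k := by positivity
  set u' : X := k⁻¹ • (u m + w) with hu'
  have h2 : A m u' ≤ 2 := by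
    have := (hA m).conv (u m + w) 0 k⁻¹ (1 - k⁻¹) (by positivity)
      (by rw [sub_nonneg]; exact inv_le_one_of_one_le₀ (by linarith)) (by ring)
    rw [smul_zero, add_zero] at this
    have h0 := hA1 m 0
    rw [hN.zero] at h0
    have h3 : 0 ≤ 1 - k⁻¹ := by rw [sub_nonneg]; exact inv_le_one_of_one_le₀ (by linarith)
    have h4 : k⁻¹ * A m (u m + w) ≤ k⁻¹ * (k + 1) :=
      mul_le_mul_of_nonneg_left (by linarith [hu m]) (by positivity)
    have h5 : k⁻¹ * (k + 1) = 1 + k⁻¹ := by field_simp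
    nlinarith
  have h3 : y + lamm m • (u' - u m) ∈ SS A := by
    refine ⟨Function.update u m u', ?_, ?_⟩
    · intro j
      rcases eq_or_ne j m with rfl | hj
      · simpa using h2
      · simpa [Function.update_of_ne hj] using hu j
    · have := hs.update m (lamm m • u')
      convert this using 1
      · funext j
        rcases eq_or_ne j m with rfl | hj
        · simp
        · simp [Function.update_of_ne hj]
      · rw [smul_sub]; abel
  have h4 : gauge (SS A) (y + lamm m • (u' - u m)) ≤ 1 := gauge_le_one_of_mem h3
  have h5 : y + lamm m • w = (y + lamm m • (u' - u m)) + (lamm m * (2 * e)) • u' := by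
    have : w = k • u' - u m := by rw [hu', smul_smul, mul_inv_cancel₀ hk0.ne', one_smul]; abel
    rw [this, hk]; module
  rw [h5]
  refine (hP.add_le _ _).trans ?_
  have hl := lamm_pos m
  rw [hP.smul_nn (by positivity)]
  have h6 : gauge (SS A) u' ≤ 2 := (hle u').trans (((hA m).ge _).trans h2)
  have h7 : lamm m * (2 * e) * gauge (SS A) u' ≤ lamm m * (2 * e) * 2 :=
    mul_le_mul_of_nonneg_left h6 (by positivity)
  linarith

theorem beta_aus {N : X → ℝ} (hN : IsEquivNorm N) (h : NormHasPropertyBeta N) :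
    ∃ P : X → ℝ, IsEquivNorm P ∧ AUSNorm P := by
  obtain ⟨θ, hθ, hθ1, hgame⟩ := beta_game hN h
  have hθ0 : 0 < θ := by linarith
  choose A hA hA1 hA2 using fun m => exists_level hN hθ0 hθ1 hgame m
  obtain ⟨hab, hP, hle, hge⟩ := gauge_equiv hN (SS_convex hA) (SS_neg hA)
    (fun x hx => SS_big hA1 hx) (fun x hx => SS_small hN hA hx)
  refine ⟨gauge (SS A), hP, aus_of_filter hP fun ε hε => ?_⟩
  obtain ⟨m, hm⟩ := exists_pow_lt_of_lt_one (show (0:ℝ) < ε / 16 by positivity) hθ1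
  set s : ℝ := (1/2)^m with hs
  have hs0 : 0 < s := by positivity
  have hl := lamm_pos m
  set σ : ℝ := lamm m * s / 2 with hσ
  have hσ0 : 0 < σ := by positivity
  refine ⟨σ, hσ0, fun x hx => ?_⟩
  set B : ℝ := (1 + ε * σ) / (1 + ε * σ / 2) with hB
  have hB1 : 1 < B := by
    rw [hB, one_lt_div (by positivity)]
    nlinarith [mul_pos hε hσ0]
  have hxB : gauge (SS A) x < B := by rw [hx]; exact hB1
  obtain ⟨b, hb, hbB, y, hy, hyx⟩ := exists_lt_of_gauge_lt hab hxB
  have hyx : b • y = x := hyx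
  have hb1 : 1 ≤ b := by
    have : gauge (SS A) y ≤ 1 := gauge_le_one_of_mem hy
    have h2 : gauge (SS A) x = b * gauge (SS A) y := by rw [← hyx, hP.smul_nn hb.le]
    rw [hx] at h2
    nlinarith
  have hst := SS_step hN hA hA1 hab (m := m) (e := s * θ ^ m) (r := s) (by positivity)
    (fun x => hA2 m x) hy
  filter_upwards [ev_smul hst (b * lamm m)⁻¹] with w hw hwσ
  have h1 : N ((b * lamm m)⁻¹ • w) ≤ s := by
    rw [hN.smul_nn (by positivity), inv_mul_le_iff₀ (by positivity)]
    have := hge w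
    have : N w ≤ lamm m * s := by linarith
    nlinarith [mul_pos hl hs0]
  have h2 := hw h1
  have h3 : x + w = b • (y + lamm m • (b * lamm m)⁻¹ • w) := by
    rw [smul_add, hyx, smul_smul, smul_smul, mul_inv_cancel₀ (by positivity), one_smul]
  rw [h3, hP.smul_nn hb.le]
  have h4 : 1 + 4 * lamm m * (s * θ ^ m) ≤ 1 + ε * σ / 2 := by
    rw [hσ]; nlinarith [mul_pos hl hs0]
  calc b * gauge (SS A) (y + lamm m • (b * lamm m)⁻¹ • w) ≤ b * (1 + ε * σ / 2) :=
        mul_le_mul_of_nonneg_left (h2.trans h4) hb.le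
    _ ≤ B * (1 + ε * σ / 2) := mul_le_mul_of_nonneg_right hbB.le (by positivity)
    _ = 1 + ε * σ := by rw [hB]; field_simp

/-- inf-max convolution: unit ball is the mean of the unit balls -/
def mx (f g : X → ℝ) (x : X) : ℝ := sInf (range fun y => max (f (x + y)) (g (x - y)))

/-- pair of close norms -/
structure NPair (f g : X → ℝ) (c : ℝ) : Prop where
  hf : IsEquivNorm f
  hg : IsEquivNorm g
  hc : 0 ≤ c
  le : ∀ x, g x ≤ f x
  ge : ∀ x, f x ≤ (1 + c) * g x

lemma mx_bdd {f g : X → ℝ} {c : ℝ} (h : NPair f g c) (x : X) :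
    BddBelow (range fun y => max (f (x + y)) (g (x - y))) :=
  ⟨0, by rintro _ ⟨y, rfl⟩; exact (h.hf.nonneg _).trans (le_max_left _ _)⟩

lemma mx_le {f g : X → ℝ} {c : ℝ} (h : NPair f g c) {x y : X} {a : ℝ} (h1 : f (x + y) ≤ a)
    (h2 : g (x - y) ≤ a) : mx f g x ≤ a :=
  (csInf_le (mx_bdd h x) ⟨y, rfl⟩).trans (max_le h1 h2)

lemma mx_lt {f g : X → ℝ} {x : X} {a : ℝ} (h : mx f g x < a) :
    ∃ y, f (x + y) < a ∧ g (x - y) < a := by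
  obtain ⟨_, ⟨y, rfl⟩, hy⟩ := exists_lt_of_csInf_lt (range_nonempty _) h
  exact ⟨y, max_lt_iff.1 hy⟩

lemma le_mx {f g : X → ℝ} {x : X} {a : ℝ}
    (h : ∀ y b, f (x + y) ≤ b → g (x - y) ≤ b → a ≤ b) : a ≤ mx f g x := by
  apply le_csInf (range_nonempty _)
  rintro _ ⟨y, rfl⟩
  exact h y _ (le_max_left _ _) (le_max_right _ _)

lemma two_mid {f : X → ℝ} (hf : IsEquivNorm f) (x y : X) : 2 * f x ≤ f (x + y) + f (x - y) := by
  have := hf.add_le (x + y) (x - y)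
  rw [show x + y + (x - y) = (2:ℝ) • x by module, hf.smul_nn (by norm_num)] at this
  exact this

lemma le_mx_g {f g : X → ℝ} {c : ℝ} (h : NPair f g c) (x : X) : g x ≤ mx f g x := by
  apply le_mx
  intro y b h1 h2
  linarith [two_mid h.hg x y, h.le (x + y)]

lemma le_mx_f {f g : X → ℝ} {c : ℝ} (h : NPair f g c) (x : X) : f x ≤ (1 + c / 2) * mx f g x := by
  have hc := h.hc
  rw [← div_le_iff₀' (by positivity)]
  apply le_mx
  intro y b h1 h2
  rw [div_le_iff₀' (by positivity)]
  nlinarith [two_mid h.hf x y, h.ge (x - y)]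

lemma mx_smul_le {f g : X → ℝ} {c : ℝ} (h : NPair f g c) (a : ℝ) (x : X) :
    mx f g (a • x) ≤ |a| * mx f g x := by
  rcases eq_or_ne a 0 with rfl | ha
  · simp only [zero_smul, abs_zero, zero_mul]
    exact mx_le h (y := 0) (by simp [h.hf.zero]) (by simp [h.hg.zero])
  · have ha' : 0 < |a| := abs_pos.2 ha
    rw [← div_le_iff₀' ha']
    apply le_mx
    intro y b h1 h2
    rw [div_le_iff₀' ha']
    apply mx_le h (y := a • y)
    · rw [← smul_add, h.hf.smul]; gcongr
    · rw [← smul_sub, h.hg.smul]; gcongr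

lemma mx_avg {f g : X → ℝ} {c : ℝ} (h : NPair f g c) (x : X) :
    mx f g x ≤ (f x + g x) / 2 := by
  rcases eq_or_ne x 0 with rfl | hx
  · exact mx_le h (y := 0) (by simp [h.hf.zero, h.hg.zero]) (by simp [h.hg.zero, h.hf.zero])
  · have hF := h.hf.pos hx
    have hG := h.hg.pos hx
    set F := f x with hFd
    set G := g x with hGd
    have key : 2 * G / (F + G) * F ≤ (F + G) / 2 := by
      rw [div_mul_eq_mul_div, div_le_iff₀ (by positivity)]
      nlinarith [sq_nonneg (F - G)]
    apply mx_le h (y := ((G - F) / (F + G)) • x)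
    · have : x + ((G - F) / (F + G)) • x = (2 * G / (F + G)) • x := by
        rw [show (2 * G / (F + G)) = 1 + (G - F) / (F + G) by field_simp; ring]; module
      rw [this, h.hf.smul_nn (by positivity)]
      exact key
    · have : x - ((G - F) / (F + G)) • x = (2 * F / (F + G)) • x := by
        rw [show (2 * F / (F + G)) = 1 - (G - F) / (F + G) by field_simp; ring]; module
      rw [this, h.hg.smul_nn (by positivity)]
      calc 2 * F / (F + G) * G = 2 * G / (F + G) * F := by ring
        _ ≤ _ := key

lemma equiv_of_between {f g P : X → ℝ} (hf : IsEquivNorm f) (hg : IsEquivNorm g)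
    (h1 : ∀ x, g x ≤ P x) (h2 : ∀ x, P x ≤ f x) (hadd : ∀ x y, P (x + y) ≤ P x + P y)
    (hsm : ∀ (a : ℝ) (x : X), P (a • x) ≤ |a| * P x) : IsEquivNorm P := by
  refine ⟨hadd, fun a x => le_antisymm (hsm a x) ?_, ?_⟩
  · rcases eq_or_ne a 0 with rfl | ha
    · simp only [zero_smul, abs_zero, zero_mul]
      have := h1 0
      rwa [hg.zero] at this
    · have := hsm a⁻¹ (a • x)
      rw [smul_smul, inv_mul_cancel₀ ha, one_smul, abs_inv, le_inv_mul_iff₀ (abs_pos.2 ha)] at this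
      exact this
  · obtain ⟨_, _, c, hc, _, _, hgb⟩ := hg
    obtain ⟨_, _, _, _, C, hC, hfb⟩ := hf
    exact ⟨c, hc, C, hC, fun x => ⟨(hgb x).1.trans (h1 x), (h2 x).trans (hfb x).2⟩⟩

lemma NPair.step {f g : X → ℝ} {c : ℝ} (h : NPair f g c) :
    NPair (fun x => (f x + g x) / 2) (mx f g) (c / 4) where
  hf := by
    apply equiv_of_between h.hf h.hg
    · intro x; linarith [h.le x]
    · intro x; linarith [h.le x]
    · intro x y; linarith [h.hf.add_le x y, h.hg.add_le x y]
    · intro a x; rw [h.hf.smul, h.hg.smul]; linarith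
  hg := by
    apply equiv_of_between h.hf h.hg (le_mx_g h)
    · intro x; linarith [h.le x, mx_avg h x]
    · intro x y
      have : ∀ a b, mx f g x < a → mx f g y < b → mx f g (x + y) ≤ a + b := by
        intro a b ha hb
        obtain ⟨u, hu1, hu2⟩ := mx_lt ha
        obtain ⟨v, hv1, hv2⟩ := mx_lt hb
        apply mx_le h (y := u + v)
        · rw [show x + y + (u + v) = (x + u) + (y + v) by abel]
          linarith [h.hf.add_le (x + u) (y + v)]
        · rw [show x + y - (u + v) = (x - u) + (y - v) by abel]
          linarith [h.hg.add_le (x - u) (y - v)]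
      apply le_of_forall_pos_le_add
      intro e he
      have := this (mx f g x + e / 2) (mx f g y + e / 2) (by linarith) (by linarith)
      linarith
    · exact mx_smul_le h
  hc := by have := h.hc; positivity
  le := mx_avg h
  ge x := by
    have := le_mx_f h x
    have := le_mx_g h x
    linarith

def FG (f g : X → ℝ) : ℕ → (X → ℝ) × (X → ℝ)
  | 0 => (f, g)
  | n + 1 => (fun x => ((FG f g n).1 x + (FG f g n).2 x) / 2, mx (FG f g n).1 (FG f g n).2)

lemma FG_pair {f g : X → ℝ} {c : ℝ} (h : NPair f g c) (n : ℕ) :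
    NPair (FG f g n).1 (FG f g n).2 (c / 4 ^ n) := by
  induction n with
  | zero => simpa [FG] using h
  | succ n ih =>
    have := ih.step
    rw [div_div, ← pow_succ] at this
    exact this

lemma FG_anti {f g : X → ℝ} {c : ℝ} (h : NPair f g c) (x : X) :
    Antitone fun n => (FG f g n).1 x := by
  apply antitone_nat_of_succ_le
  intro n
  have := (FG_pair h n).le x
  simp only [FG]
  linarith

lemma FG_mono {f g : X → ℝ} {c : ℝ} (h : NPair f g c) (x : X) :
    Monotone fun n => (FG f g n).2 x := by
  apply monotone_nat_of_le_succ
  intro n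
  exact le_mx_g (FG_pair h n) x

lemma FG_cross {f g : X → ℝ} {c : ℝ} (h : NPair f g c) (x : X) (m n : ℕ) :
    (FG f g m).2 x ≤ (FG f g n).1 x :=
  (FG_mono h x (le_max_left m n)).trans
    (((FG_pair h (max m n)).le x).trans (FG_anti h x (le_max_right m n)))

def pN (f g : X → ℝ) (x : X) : ℝ := ⨆ n, (FG f g n).2 x

lemma le_pN {f g : X → ℝ} {c : ℝ} (h : NPair f g c) (x : X) (n : ℕ) :
    (FG f g n).2 x ≤ pN f g x :=
  le_ciSup (f := fun n => (FG f g n).2 x)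
    ⟨(FG f g 0).1 x, by rintro _ ⟨m, rfl⟩; exact FG_cross h x m 0⟩ n

lemma pN_le {f g : X → ℝ} {c : ℝ} (h : NPair f g c) (x : X) (n : ℕ) :
    pN f g x ≤ (FG f g n).1 x :=
  ciSup_le fun m => FG_cross h x m n

lemma pN_norm {f g : X → ℝ} {c : ℝ} (h : NPair f g c) : IsEquivNorm (pN f g) := by
  apply equiv_of_between h.hf h.hg (fun x => le_pN h x 0) (fun x => pN_le h x 0)
  · intro x y
    apply ciSup_le
    intro n
    linarith [(FG_pair h n).hg.add_le x y, le_pN h x n, le_pN h y n]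
  · intro a x
    apply ciSup_le
    intro n
    rw [(FG_pair h n).hg.smul]
    exact mul_le_mul_of_nonneg_left (le_pN h x n) (abs_nonneg a)

/-! convexity -/

lemma auc_gain (hX : ¬ FiniteDimensional ℝ X) {N : X → ℝ} (hN : IsEquivNorm N) (h : AUCNorm N)
    {R t : ℝ} (hR : 0 < R) (ht : 0 < t) :
    ∃ d > 0, ∀ x, N x ≤ R → ∀ᶠ w in fcf X, t ≤ N w → N x + d ≤ N (x + w) := by
  obtain ⟨δ, hδ, h1⟩ := filter_of_auc hX hN h (t / R) (by positivity)
  refine ⟨min (t / 2) (t * δ / 4), by positivity, fun x hx => ?_⟩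
  rcases lt_or_ge (N x) (t / 4) with hr | hr
  · refine Eventually.of_forall fun w hw => ?_
    have := hN.le_add' w x
    rw [add_comm w x] at this
    linarith [min_le_left (t / 2) (t * δ / 4)]
  · have hr0 : 0 < N x := by linarith
    have hu : N ((N x)⁻¹ • x) = 1 := by
      rw [hN.smul_nn (by positivity), inv_mul_cancel₀ hr0.ne']
    filter_upwards [ev_smul (h1 _ hu) (N x)⁻¹] with w hw htw
    rw [← smul_add, hN.smul_nn (by positivity), hN.smul_nn (by positivity)] at hw
    have h2 : t / R ≤ (N x)⁻¹ * N w := by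
      rw [div_le_iff₀ hR, mul_assoc, le_inv_mul_iff₀ hr0]
      nlinarith
    have h3 := hw h2
    rw [le_inv_mul_iff₀ hr0] at h3
    have := min_le_right (t / 2) (t * δ / 4)
    nlinarith

lemma FG_gain {f g : X → ℝ} {c : ℝ} (h : NPair f g c) {D T : X → Prop} {d : ℝ}
    (hd : ∀ x, D x → ∀ᶠ w in fcf X, T w → f x + d ≤ f (x + w)) (n : ℕ) :
    ∀ x, D x → ∀ᶠ w in fcf X, T w → (FG f g n).1 x + d / 2 ^ n ≤ (FG f g n).1 (x + w) := by
  induction n with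
  | zero => simpa [FG] using hd
  | succ n ih =>
    intro x hx
    filter_upwards [ih x hx, ev_lsc (FG_pair h n).hg x] with w h1 h2 hw
    have h3 := h1 hw
    simp only [FG]
    rw [pow_succ, ← div_div]
    linarith

lemma pN_conv {f g : X → ℝ} {c : ℝ} (h : NPair f g c)
    (hf : ∀ R > 0, ∀ t > 0, ∃ d > 0, ∀ x, f x ≤ R → ∀ᶠ w in fcf X, t ≤ f w → f x + d ≤ f (x + w)) :
    ∀ t > 0, ∃ η > 0, ∀ x, pN f g x ≤ 1 → ∀ᶠ w in fcf X, t ≤ pN f g w →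
      pN f g x + η ≤ pN f g (x + w) := by
  intro t ht
  have hc := h.hc
  obtain ⟨d, hd, h1⟩ := hf (1 + c) (by positivity) t ht
  obtain ⟨n, hn⟩ := pow_unbounded_of_one_lt (8 * c / d) (one_lt_two)
  have h2n : (0:ℝ) < 2 ^ n := by positivity
  set a : ℝ := d / 2 ^ n with ha
  have ha0 : 0 < a := by positivity
  have hca : 8 * (c / 4 ^ n) ≤ a := by
    rw [div_lt_iff₀ hd] at hn
    rw [ha, show (4:ℝ) ^ n = 2 ^ n * 2 ^ n by rw [← mul_pow]; norm_num, ← mul_div_assoc,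
      ← div_div, div_le_div_iff_of_pos_right h2n, div_le_iff₀ h2n]
    linarith
  refine ⟨min (a / 4) 1, by positivity, fun x hx => ?_⟩
  have hD : f x ≤ 1 + c := by
    have h3 := h.ge x
    have h4 : g x ≤ 1 := (le_pN h x 0).trans hx
    nlinarith
  filter_upwards [FG_gain h (D := fun x => f x ≤ 1 + c) (T := fun w => t ≤ f w) h1 n x hD] with w hw htw
  have h5 := hw (htw.trans (pN_le h w 0))
  have h6 := pN_le h x n
  have h7 := (FG_pair h n).ge (x + w)
  have h8 := le_pN h (x + w) n
  have hcn : 0 ≤ c / 4 ^ n := (FG_pair h n).hc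
  by_contra hcon
  push Not at hcon
  have m1 := min_le_left (a / 4) 1
  have m2 := min_le_right (a / 4) 1
  have h9 : pN f g (x + w) ≤ 2 := by linarith
  nlinarith

/-! smoothness -/

def Smo (g₀ g : X → ℝ) (s η : ℝ) : Prop :=
  ∀ x, g x < 1 → ∀ᶠ w in fcf X, g₀ w ≤ s → ∃ x', g x' ≤ 1 ∧ g₀ (x + w - x') ≤ η

lemma Smo.step {f g g₀ : X → ℝ} {c s η : ℝ} (h : NPair f g c) (h0 : IsEquivNorm g₀)
    (hs : Smo g₀ g s η) : Smo g₀ (mx f g) (s / 2) (η / 2) := by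
  intro x hx
  obtain ⟨y, hy1, hy2⟩ := mx_lt hx
  filter_upwards [ev_smul (hs _ hy2) 2] with w hw hws
  obtain ⟨v, hv1, hv2⟩ := hw (by rw [h0.smul_nn (by norm_num)]; linarith)
  refine ⟨(1/2 : ℝ) • (x + y + v), ?_, ?_⟩
  · apply mx_le h (y := (1/2 : ℝ) • (x + y - v))
    · rw [show (1/2 : ℝ) • (x + y + v) + (1/2 : ℝ) • (x + y - v) = x + y by module]
      exact hy1.le
    · rw [show (1/2 : ℝ) • (x + y + v) - (1/2 : ℝ) • (x + y - v) = v by module]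
      exact hv1
  · rw [show x + w - (1/2 : ℝ) • (x + y + v) = (1/2 : ℝ) • (x - y + (2:ℝ) • w - v) by module,
      h0.smul_nn (by norm_num)]
    linarith

lemma Smo.base {g : X → ℝ} (hg : IsEquivNorm g) (h : AUSNorm g) {ε : ℝ} (hε : 0 < ε) :
    ∃ s > 0, s ≤ 1 ∧ Smo g g s (ε * s) := by
  obtain ⟨σ, hσ, h1⟩ := filter_of_aus hg h (ε / 2) (by positivity)
  have hs0 : 0 < min (σ / 2) (1 / 2) := by positivity
  refine ⟨min (σ / 2) (1 / 2), hs0, (min_le_right _ _).trans (by norm_num), fun x hx => ?_⟩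
  set s := min (σ / 2) (1 / 2) with hs
  have hs1 : s ≤ σ / 2 := min_le_left _ _
  have hs2 : s ≤ 1 / 2 := min_le_right _ _
  rcases lt_or_ge (g x) (1 / 2) with hr | hr
  · refine Eventually.of_forall fun w hw => ⟨x + w, ?_, ?_⟩
    · linarith [hg.add_le x w]
    · rw [sub_self, hg.zero]; positivity
  · have hr0 : 0 < g x := by linarith
    have hu : g ((g x)⁻¹ • x) = 1 := by
      rw [hg.smul_nn (by positivity), inv_mul_cancel₀ hr0.ne']
    filter_upwards [ev_smul (h1 (2 * s) (by positivity) (by linarith) _ hu) (g x)⁻¹] with w hw hws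
    rw [← smul_add, hg.smul_nn (by positivity), hg.smul_nn (by positivity)] at hw
    have h2 := hw (by rw [inv_mul_le_iff₀ hr0]; nlinarith)
    rw [inv_mul_le_iff₀ hr0] at h2
    set k := 1 + ε * s with hk
    have hk0 : 0 < k := by positivity
    have h3 : g (x + w) ≤ k := by nlinarith [mul_pos hε hs0]
    have h4 : g (k⁻¹ • (x + w)) ≤ 1 := by
      rw [hg.smul_nn (by positivity), inv_mul_le_iff₀ hk0]; linarith
    refine ⟨k⁻¹ • (x + w), h4, ?_⟩
    have h5 : x + w - k⁻¹ • (x + w) = (ε * s) • (k⁻¹ • (x + w)) := by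
      have : ε * s * k⁻¹ = 1 - k⁻¹ := by rw [hk]; field_simp; ring
      rw [smul_smul, this]; module
    rw [h5, hg.smul_nn (by positivity)]
    nlinarith [mul_pos hε hs0]

lemma FG_smo {f g : X → ℝ} {c s η : ℝ} (h : NPair f g c) (hs : Smo g g s η) (n : ℕ) :
    Smo g (FG f g n).2 (s / 2 ^ n) (η / 2 ^ n) := by
  induction n with
  | zero => simpa [FG] using hs
  | succ n ih =>
    have := ih.step (FG_pair h n) h.hg
    rw [div_div, div_div, ← pow_succ] at this
    exact this

lemma pN_smooth {f g : X → ℝ} {c : ℝ} (h : NPair f g c) (hg : AUSNorm g) :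
    ∀ ε > 0, ∃ s > 0, s ≤ 1 ∧ ∀ x, pN f g x < 1 → ∀ᶠ w in fcf X, pN f g w ≤ s →
      pN f g (x + w) ≤ 1 + ε * s := by
  intro ε hε
  have hc := h.hc
  obtain ⟨σ, hσ, hσ1, hS⟩ := Smo.base h.hg hg (show 0 < ε / (2 * (1 + c)) by positivity)
  obtain ⟨n, hn⟩ := pow_unbounded_of_one_lt (2 * c / (ε * σ)) (one_lt_two)
  have h2n : (0:ℝ) < 2 ^ n := by positivity
  have hSn := FG_smo h hS n
  set s : ℝ := σ / 2 ^ n with hs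
  have hs0 : 0 < s := by positivity
  have hca : c / 4 ^ n ≤ ε * s / 2 := by
    rw [div_lt_iff₀ (by positivity)] at hn
    rw [hs, show (4:ℝ) ^ n = 2 ^ n * 2 ^ n by rw [← mul_pow]; norm_num, ← div_div,
      mul_div_assoc', div_div (ε * σ), mul_comm (2 ^ n) (2:ℝ), ← div_div (ε * σ),
      div_le_div_iff_of_pos_right h2n, div_le_iff₀ h2n]
    linarith
  refine ⟨s, hs0, (div_le_self hσ.le (one_le_pow₀ one_le_two)).trans hσ1, fun x hx => ?_⟩
  filter_upwards [hSn x ((le_pN h x n).trans_lt hx)] with w hw hws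
  obtain ⟨x', h1, h2⟩ := hw ((le_pN h w 0).trans hws)
  have h3 := (pN_norm h).add_le x' (x + w - x')
  rw [add_sub_cancel] at h3
  have h4 := (pN_le h x' n).trans ((FG_pair h n).ge x')
  have h5 : pN f g (x + w - x') ≤ (1 + c) * g (x + w - x') := (pN_le h _ 0).trans (h.ge _)
  have h6 : (1 + c) * g (x + w - x') ≤ (1 + c) * (ε / (2 * (1 + c)) * σ / 2 ^ n) :=
    mul_le_mul_of_nonneg_left h2 (by positivity)
  have h7 : (1 + c) * (ε / (2 * (1 + c)) * σ / 2 ^ n) = ε * s / 2 := by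
    rw [hs]; field_simp
  have hcn : 0 ≤ c / 4 ^ n := (FG_pair h n).hc
  have h8 : (1 + c / 4 ^ n) * (FG f g n).2 x' ≤ 1 + c / 4 ^ n := by nlinarith
  linarith

lemma weak_lim (hr : Function.Surjective (NormedSpace.inclusionInDoubleDual ℝ X))
    {xs : ℕ → X} {M : ℝ} (hM : ∀ n, ‖xs n‖ ≤ M) (U : Ultrafilter ℕ) :
    ∃ y : X, ∀ f : X →L[ℝ] ℝ, Tendsto (fun n => f (xs n)) U (𝓝 (f y)) := by
  let φ : ℕ → WeakDual ℝ (StrongDual ℝ X) := fun n =>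
    StrongDual.toWeakDual (NormedSpace.inclusionInDoubleDual ℝ X (xs n))
  have hK := WeakDual.isCompact_closedBall (𝕜 := ℝ) (E := StrongDual ℝ X) 0 M
  obtain ⟨F, -, hF⟩ := hK.ultrafilter_le_nhds (U.map φ) (by
    rw [Ultrafilter.coe_map, le_principal_iff, mem_map]
    refine univ_mem' fun n => ?_
    show NormedSpace.inclusionInDoubleDual ℝ X (xs n) ∈ closedBall 0 M
    have hh : ‖NormedSpace.inclusionInDoubleDual ℝ X (xs n)‖ ≤ M := by
      refine (ContinuousLinearMap.le_of_opNorm_le _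
        (NormedSpace.inclusionInDoubleDual_norm_le ℝ X) (xs n)).trans ?_
      rw [one_mul]; exact hM n
    exact (mem_closedBall_zero_iff (a := NormedSpace.inclusionInDoubleDual ℝ X (xs n))).2 hh)
  obtain ⟨y, hy⟩ := hr (WeakDual.toStrongDual F)
  refine ⟨y, fun f => ?_⟩
  have h1 : Tendsto φ U (𝓝 F) := hF
  have h2 := ((WeakDual.eval_continuous f).tendsto F).comp h1
  have h3 : F f = f y := by
    have : NormedSpace.inclusionInDoubleDual ℝ X y f = F f := by rw [hy]; rfl
    rw [← this]; rfl
  rw [h3] at h2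
  exact h2

lemma fin_approx {Z : Subspace ℝ X} (hZ : FinCodim Z) :
    ∃ T : X → X, (∀ x, x - T x ∈ Z) ∧ ∀ (z : ℕ → X) (U : Filter ℕ),
      (∀ f : X →L[ℝ] ℝ, Tendsto (fun n => f (z n)) U (𝓝 0)) →
      Tendsto (fun n => T (z n)) U (𝓝 0) := by
  obtain ⟨hcl, hfd⟩ := hZ
  have := hcl
  have := hfd
  let b := Module.finBasis ℝ (X ⧸ Z)
  choose e he using fun i => Submodule.mkQ_surjective Z (b i)
  let F : ∀ i, X →L[ℝ] ℝ := fun i => (LinearMap.toContinuousLinearMap (b.coord i)).comp Z.mkQL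
  refine ⟨fun x => ∑ i, F i x • e i, fun x => ?_, fun z U h => ?_⟩
  · rw [← Submodule.Quotient.mk_eq_zero, ← Submodule.mkQ_apply, map_sub, map_sum]
    simp only [map_smul, he]
    have : ∑ i, F i x • b i = Z.mkQ x := b.sum_repr (Z.mkQ x)
    rw [this, sub_self]
  · have : Tendsto (fun n => ∑ i, F i (z n) • e i) U (𝓝 (∑ i, (0:ℝ) • e i)) :=
      tendsto_finsetSum _ fun i _ => (h (F i)).smul_const (e i)
    simpa using this


theorem beta_of_conv_smooth {p : X → ℝ} (hp : IsEquivNorm p)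
    (hr : Function.Surjective (NormedSpace.inclusionInDoubleDual ℝ X))
    (hC : ∀ t > 0, ∃ η > 0, ∀ x, p x ≤ 1 → ∀ᶠ w in fcf X, t ≤ p w → p x + η ≤ p (x + w))
    (hS : ∀ ε > 0, ∃ s > 0, s ≤ 1 ∧
      ∀ x, p x < 1 → ∀ᶠ w in fcf X, p w ≤ s → p (x + w) ≤ 1 + ε * s) :
    NormHasPropertyBeta p := by
  refine ⟨1, le_rfl, one_le_two, fun t ht _ => ?_⟩
  obtain ⟨η, hη, hC⟩ := hC (t / 4) (by positivity)
  obtain ⟨s, hs, hs1, hS⟩ := hS (η / 64) (by positivity)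
  refine ⟨s / 3 * η / 32, by positivity, fun x hx xs hxs hsep => ?_⟩
  let U : Ultrafilter ℕ := Filter.hyperfilter ℕ
  obtain ⟨c, hc, C, hCC, hb⟩ := hp.2.2
  obtain ⟨y, hy⟩ := weak_lim hr (M := 1 / c) (fun n => by
    rw [le_div_iff₀ hc]; linarith [(hb (xs n)).1, hxs n]) U
  have hz : ∀ f : X →L[ℝ] ℝ, Tendsto (fun n => f (xs n - y)) U (𝓝 0) := by
    intro f
    have := (hy f).sub_const (f y)
    simpa [map_sub] using this
  have hapx : ∀ Q : X → Prop, (∀ᶠ w in fcf X, Q w) → ∀ e > 0,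
      ∀ᶠ n in (U : Filter ℕ), ∃ z', Q z' ∧ p (xs n - y - z') ≤ e := by
    intro Q hQ e he
    obtain ⟨Z, hZ, hZQ⟩ := ev_fcf.1 hQ
    obtain ⟨T, hT, hT0⟩ := fin_approx hZ
    have h1 := (hp.continuous.tendsto 0).comp (hT0 _ _ hz)
    rw [hp.zero] at h1
    filter_upwards [h1.eventually_le_const he] with n hn
    refine ⟨_, hZQ _ (hT (xs n - y)), ?_⟩
    rw [sub_sub_cancel]
    exact hn
  have hy1 : p y ≤ 1 := by
    obtain ⟨f, hf, hfp⟩ := hp.exists_norming y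
    rw [← hf]
    exact le_of_tendsto (hy f) (Eventually.of_forall fun n => (hfp _).trans (hxs n))
  have hbig : ∀ᶠ n in (U : Filter ℕ), t / 2 ≤ p (xs n - y) := by
    have hfin : {n | ¬ t / 2 ≤ p (xs n - y)}.Finite := by
      apply Set.Subsingleton.finite
      intro m hm n hn
      by_contra hmn
      have h1 := hsep m n hmn
      have h2 := hp.sub_le (xs m - y) (xs n - y)
      rw [sub_sub_sub_cancel_right] at h2
      simp only [mem_ofPred_eq, not_le] at hm hn
      linarith
    have h3 : ∀ᶠ n in Filter.cofinite, t / 2 ≤ p (xs n - y) := hfin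
    exact (Filter.hyperfilter_le_cofinite) h3
  -- the weak limit is deep inside the ball
  have hyη : p y + η / 2 ≤ 1 := by
    obtain ⟨n, h1, z', hz', h2⟩ := (hbig.and (hapx _ (hC y hy1) (min (η / 2) (t / 4))
      (by positivity))).exists
    have m1 := min_le_left (η / 2) (t / 4)
    have m2 := min_le_right (η / 2) (t / 4)
    have h3 := hp.sub_comm (xs n - y) z'
    have h4 := hp.le_sub (xs n - y) (xs n - y - z')
    rw [sub_sub_cancel] at h4
    have h5 := hz' (by linarith)
    have h6 := hp.le_sub (y + z') (-(xs n - y - z'))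
    rw [hp.neg, show y + z' - -(xs n - y - z') = xs n by abel] at h6
    linarith [hxs n]
  have hpy := hp.nonneg y
  set r : ℝ := s / 3 with hrd
  have hr0 : 0 < r := by positivity
  set A : ℝ := 1 + r * (1 - η / 4) with hA
  have hη2 : η ≤ 2 := by linarith
  have hA1 : 1 ≤ A := by nlinarith
  have hA2 : A ≤ 2 := by nlinarith
  have hA0 : 0 < A := by linarith
  have hq : p (A⁻¹ • (x - r • y)) < 1 := by
    rw [hp.smul_nn (by positivity), inv_mul_lt_iff₀ hA0, mul_one]
    have := hp.sub_le x (r • y)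
    rw [hp.smul_nn hr0.le] at this
    nlinarith
  obtain ⟨n, z', hz', h2⟩ := (hapx _ (ev_smul (hS _ hq) (-(A⁻¹ * r))) (min (η / 16) 1)
    (by positivity)).exists
  have m1 := min_le_left (η / 16) 1
  have m2 := min_le_right (η / 16) 1
  refine ⟨n, ?_⟩
  have h3 : p z' ≤ 3 := by
    have h4 := hp.sub_le (xs n - y) (xs n - y - z')
    rw [sub_sub_cancel] at h4
    have := hp.sub_le (xs n) y
    linarith [hxs n]
  have h4 : p (-(A⁻¹ * r) • z') ≤ s := by
    rw [neg_smul, hp.neg, hp.smul_nn (by positivity), mul_assoc, inv_mul_le_iff₀ hA0]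
    nlinarith
  have h5 := hz' h4
  rw [show A⁻¹ • (x - r • y) + -(A⁻¹ * r) • z' = A⁻¹ • (x - r • y - r • z') by module,
    hp.smul_nn (by positivity), inv_mul_le_iff₀ hA0] at h5
  have h6 := hp.sub_le (x - r • y - r • z') (r • (xs n - y - z'))
  rw [show x - r • y - r • z' - r • (xs n - y - z') = x - r • xs n by module,
    hp.smul_nn hr0.le] at h6
  have h7 := hp.sub_le (x - r • xs n) ((1 - r) • xs n)
  rw [show x - r • xs n - (1 - r) • xs n = x - xs n by module,
    hp.smul_nn (by linarith)] at h7
  have h8 : (1 - r) * p (xs n) ≤ 1 - r := by nlinarith [hxs n]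
  have h9 : r * p (xs n - y - z') ≤ r * (η / 16) :=
    mul_le_mul_of_nonneg_left (by linarith) hr0.le
  have h10 : A * (1 + η / 64 * s) ≤ A + 2 * (η / 64 * s) := by nlinarith [mul_pos hη hs]
  have h11 : s = 3 * r := by rw [hrd]; ring
  have h12 : A = 1 + r - r * η / 4 := by rw [hA]; ring
  rw [h11] at h10
  rw [h11] at h5
  have : 0 < r * η := by positivity
  linarith

theorem beta_of_aus_auc (hX : ¬ FiniteDimensional ℝ X)
    (hr : Function.Surjective (NormedSpace.inclusionInDoubleDual ℝ X))
    {N₁ N₂ : X → ℝ} (h1 : IsEquivNorm N₁) (hs : AUSNorm N₁) (h2 : IsEquivNorm N₂)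
    (hc : AUCNorm N₂) : ∃ N : X → ℝ, IsEquivNorm N ∧ NormHasPropertyBeta N := by
  obtain ⟨c1, hc1, C1, hC1, hb1⟩ := h1.2.2
  obtain ⟨c2, hc2, C2, hC2, hb2⟩ := h2.2.2
  set K := C1 / c2 with hK
  have hK0 : 0 < K := by positivity
  have hf : IsEquivNorm (fun x => K * N₂ x) := by
    refine ⟨fun x y => ?_, fun a x => ?_, K * c2, by positivity, K * C2, by positivity,
      fun x => ⟨?_, ?_⟩⟩
    · have := h2.add_le x y; nlinarith
    · simp only [h2.smul]; ring
    · rw [mul_assoc]; exact mul_le_mul_of_nonneg_left (hb2 x).1 hK0.le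
    · rw [mul_assoc]; exact mul_le_mul_of_nonneg_left (hb2 x).2 hK0.le
  have hp : NPair (fun x => K * N₂ x) N₁ (K * C2 / c1) := by
    refine ⟨hf, h1, by positivity, fun x => ?_, fun x => ?_⟩
    · calc N₁ x ≤ C1 * ‖x‖ := (hb1 x).2
        _ = K * (c2 * ‖x‖) := by rw [hK]; field_simp
        _ ≤ K * N₂ x := mul_le_mul_of_nonneg_left (hb2 x).1 hK0.le
    · calc K * N₂ x ≤ K * (C2 * ‖x‖) := mul_le_mul_of_nonneg_left (hb2 x).2 hK0.le
        _ = (K * C2 / c1) * (c1 * ‖x‖) := by field_simp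
        _ ≤ (K * C2 / c1) * N₁ x := mul_le_mul_of_nonneg_left (hb1 x).1 (by positivity)
        _ ≤ (1 + K * C2 / c1) * N₁ x := by linarith [h1.nonneg x]
  refine ⟨pN (fun x => K * N₂ x) N₁, pN_norm hp, beta_of_conv_smooth (pN_norm hp) hr
    (pN_conv hp fun R hR t ht => ?_) (pN_smooth hp hs)⟩
  obtain ⟨d, hd, h⟩ := auc_gain hX h2 hc (R := R / K) (t := t / K) (by positivity) (by positivity)
  refine ⟨K * d, by positivity, fun x hx => ?_⟩
  filter_upwards [h x (by rw [le_div_iff₀ hK0]; linarith)] with w hw htw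
  have := hw (by rw [div_le_iff₀ hK0]; linarith)
  nlinarith

end HelperLemmas

/-- isomorphic characterization of property (β) for separable
spaces: an equivalent norm with property (β) exists iff the space is reflexive and
admits an equivalent AUS norm and an equivalent AUC norm. -/
theorem stmt10 {X : Type*} [NormedAddCommGroup X] [NormedSpace ℝ X] [CompleteSpace X]
    [TopologicalSpace.SeparableSpace X] (hX : ¬ FiniteDimensional ℝ X) :
    (∃ N : X → ℝ, IsEquivNorm N ∧ NormHasPropertyBeta N) ↔
      (Function.Surjective (NormedSpace.inclusionInDoubleDual ℝ X) ∧
        (∃ N : X → ℝ, IsEquivNorm N ∧ AUSNorm N) ∧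
        (∃ N : X → ℝ, IsEquivNorm N ∧ AUCNorm N)) := by
  constructor
  · rintro ⟨N, hN, h⟩
    exact ⟨beta_refl hN h, beta_aus hN h, N, hN, beta_auc hX hN h⟩
  · rintro ⟨hr, ⟨N₁, h1, hs⟩, N₂, h2, hc⟩
    exact beta_of_aus_auc hX hr h1 hs h2 hc

end
end

section
/- Let Y be an infinite-dimensional Banach space, u a point of the unit sphere of Y, t ∈ (0,1] and η > 0. Then there exists a 2-basic sequence (xₙ) in the unit sphere of Y such that for each n, ‖u + t·xₙ‖ ≤ 1 + δ̄_Y(t,u) + η/2. -/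
open Set Metric Filter Topology

noncomputable section

lemma exists_codim_aux {Y : Type*} [NormedAddCommGroup Y] [NormedSpace ℝ Y]
    (F : Submodule ℝ Y) [FiniteDimensional ℝ F] (r : ℝ) (hr : 0 < r) :
    ∃ Z : Subspace ℝ Y, FinCodim Z ∧ ∀ f ∈ F, ∀ z ∈ Z, (1 - r) * ‖f‖ ≤ ‖f + z‖ := by
  have hc : IsCompact (sphere (0 : F) 1) := isCompact_sphere 0 1
  obtain ⟨T, hT, hTfin, hcov⟩ := hc.finite_cover_balls hr
  have hg : ∀ x : Y, ∃ g : Y →L[ℝ] ℝ, ‖g‖ ≤ 1 ∧ g x = ‖x‖ := fun x => by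
    obtain ⟨g, h1, h2⟩ := exists_dual_vector'' ℝ x
    exact ⟨g, h1, by simpa using h2⟩
  choose g hg1 hg2 using hg
  have : Fintype T := hTfin.fintype
  let G : Y →L[ℝ] (T → ℝ) := ContinuousLinearMap.pi fun i => g ((i : F) : Y)
  refine ⟨LinearMap.ker (G : Y →ₗ[ℝ] (T → ℝ)), ⟨G.isClosed_ker, ?_⟩, ?_⟩
  · exact Module.Finite.equiv (G : Y →ₗ[ℝ] (T → ℝ)).quotKerEquivRange.symm
  · intro f hf z hz
    have hz' : ∀ i : T, g ((i : F) : Y) z = 0 := fun i => by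
      have : G z = 0 := hz
      exact congrFun this i
    rcases eq_or_ne f 0 with rfl | hf0
    · simp
    have hn : 0 < ‖f‖ := norm_pos_iff.2 hf0
    let f' : F := ‖f‖⁻¹ • ⟨f, hf⟩
    have hf' : f' ∈ sphere (0 : F) 1 := by
      rw [mem_sphere_zero_iff_norm, norm_smul]
      simp [hn.ne']
    have := hcov hf'
    simp only [mem_iUnion] at this
    obtain ⟨i, hi, hb⟩ := this
    have hi1 : ‖(i : Y)‖ = 1 := by simpa using hT hi
    have h1 : g (i : Y) f = ‖f‖ * g (i : Y) (f' : Y) := by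
      simp [f', hn.ne']
    have h2 : g (i : Y) (f' : Y) = 1 + g (i : Y) ((f' : Y) - i) := by
      rw [map_sub, hg2, hi1]; ring
    have h3 : |g (i : Y) ((f' : Y) - i)| ≤ r := by
      have h := (g (i : Y)).le_opNorm ((f' : Y) - i)
      have hb' : ‖(f' : Y) - i‖ < r := by
        rw [mem_ball, dist_eq_norm] at hb
        exact hb
      rw [Real.norm_eq_abs] at h
      nlinarith [hg1 (i : Y), norm_nonneg ((f' : Y) - i)]
    have h4 : g (i : Y) (f + z) = g (i : Y) f := by
      rw [map_add, hz' ⟨i, hi⟩, add_zero]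
    have h5 := (g (i : Y)).le_opNorm (f + z)
    rw [h4, Real.norm_eq_abs] at h5
    have h6 := le_abs_self (g (i : Y) f)
    have h7 := (abs_le.1 h3).1
    have h8 : ‖g (i : Y)‖ * ‖f + z‖ ≤ ‖f + z‖ := by
      nlinarith [hg1 (i : Y), norm_nonneg (f + z)]
    have h9 : (1 - r) * ‖f‖ ≤ g (i : Y) f := by
      rw [h1, h2]; nlinarith
    linarith

lemma exists_unit_aux {Y : Type*} [NormedAddCommGroup Y] [NormedSpace ℝ Y]
    (hY : ¬ FiniteDimensional ℝ Y) (u : Y) (hu : ‖u‖ = 1)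
    (t : ℝ) (ht0 : 0 < t) (η : ℝ) (hη : 0 < η) (Z : Subspace ℝ Y) (hZ : FinCodim Z) :
    ∃ z ∈ Z, ‖z‖ = 1 ∧ ‖u + t • z‖ ≤ 1 + deltaAt t u + η / 2 := by
  have hne : ∀ Z : Subspace ℝ Y, FinCodim Z → ∃ z ∈ Z, ‖z‖ = 1 := by
    intro Z hZ
    have hb : Z ≠ ⊥ := by
      rintro rfl
      have := hZ.2
      exact hY (Module.Finite.equiv (Submodule.quotEquivOfEqBot (⊥ : Submodule ℝ Y) rfl))
    obtain ⟨z, hz, hz0⟩ := Submodule.exists_mem_ne_zero_of_ne_bot hb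
    exact ⟨‖z‖⁻¹ • z, Z.smul_mem _ hz, by
      rw [norm_smul, norm_inv, norm_norm, inv_mul_cancel₀ (norm_ne_zero_iff.2 hz0)]⟩
  have hbdd : BddAbove {s | ∃ Z : Subspace ℝ Y, FinCodim Z ∧
      s = sInf {r | ∃ z ∈ Z, ‖z‖ = 1 ∧ r = ‖u + t • z‖ - 1}} := by
    refine ⟨t, ?_⟩
    rintro s ⟨Z, hZ, rfl⟩
    obtain ⟨z, hz, hz1⟩ := hne Z hZ
    refine le_trans (csInf_le (a := ‖u + t • z‖ - 1) ⟨-1, ?_⟩ ⟨z, hz, hz1, rfl⟩) ?_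
    · rintro _ ⟨w, -, -, rfl⟩
      linarith [norm_nonneg (u + t • w)]
    · have := norm_add_le u (t • z)
      rw [norm_smul, hz1, hu, Real.norm_eq_abs, abs_of_pos ht0] at this
      linarith
  have hle : sInf {r | ∃ z ∈ Z, ‖z‖ = 1 ∧ r = ‖u + t • z‖ - 1} ≤ deltaAt t u :=
    le_csSup hbdd ⟨Z, hZ, rfl⟩
  obtain ⟨z0, hz0, hz01⟩ := hne Z hZ
  obtain ⟨_, ⟨z, hz, hz1, rfl⟩, hlt⟩ := exists_lt_of_csInf_lt
    (⟨_, z0, hz0, hz01, rfl⟩ : {r | ∃ z ∈ Z, ‖z‖ = 1 ∧ r = ‖u + t • z‖ - 1}.Nonempty)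
    (lt_of_le_of_lt hle (by linarith : deltaAt t u < deltaAt t u + η / 2))
  exact ⟨z, hz, hz1, by linarith⟩

/-- Lemma `g_lem2`: existence of a 2-basic sequence in the unit
sphere witnessing `δ̄_Y(t, u)` up to `η/2`. -/
theorem stmt13 {Y : Type*} [NormedAddCommGroup Y] [NormedSpace ℝ Y] [CompleteSpace Y]
    (hY : ¬ FiniteDimensional ℝ Y) (u : Y) (hu : ‖u‖ = 1)
    (t : ℝ) (ht0 : 0 < t) (ht1 : t ≤ 1) (η : ℝ) (hη : 0 < η) :
    ∃ xs : ℕ → Y, (∀ n, ‖xs n‖ = 1) ∧ IsBasicWithConst 2 xs ∧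
      ∀ n, ‖u + t • xs n‖ ≤ 1 + deltaAt t u + η / 2 := by
  let K : ℕ → ℝ := fun n => 2 - 1 / ((n : ℝ) + 1)
  have hK1 : ∀ n, 1 ≤ K n := fun n => by
    have : 1 / ((n : ℝ) + 1) ≤ 1 := by
      rw [div_le_one (by positivity)]; linarith [(Nat.cast_nonneg n : (0:ℝ) ≤ n)]
    simp only [K]; linarith
  have hK2 : ∀ n, K n ≤ 2 := fun n => by
    have : 0 ≤ 1 / ((n : ℝ) + 1) := by positivity
    simp only [K]; linarith
  have hK3 : ∀ n, K n < K (n + 1) := fun n => by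
    have : 1 / (((n + 1 : ℕ) : ℝ) + 1) < 1 / ((n : ℝ) + 1) :=
      one_div_lt_one_div_of_lt (by positivity) (by push_cast; linarith)
    simp only [K]; linarith
  have key : ∀ (n : ℕ) (F : Submodule ℝ Y), ∃ z : Y, FiniteDimensional ℝ F →
      ‖z‖ = 1 ∧ ‖u + t • z‖ ≤ 1 + deltaAt t u + η / 2 ∧
      ∀ f ∈ F, ∀ a : ℝ, K n * ‖f‖ ≤ K (n + 1) * ‖f + a • z‖ := by
    intro n F
    by_cases hF : FiniteDimensional ℝ F
    · have hp : 0 < K (n + 1) := by linarith [hK1 (n + 1)]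
      obtain ⟨Z, hZ, h⟩ := exists_codim_aux F (1 - K n / K (n + 1))
        (by rw [sub_pos, div_lt_one hp]; exact hK3 n)
      obtain ⟨z, hz, h1, h2⟩ := exists_unit_aux hY u hu t ht0 η hη Z hZ
      refine ⟨z, fun _ => ⟨h1, h2, fun f hf a => ?_⟩⟩
      have h3 := h f hf (a • z) (Z.smul_mem a hz)
      have h4 := mul_le_mul_of_nonneg_left h3 hp.le
      calc K n * ‖f‖ = K (n + 1) * ((1 - (1 - K n / K (n + 1))) * ‖f‖) := by
            field_simp; ring
        _ ≤ _ := h4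
    · exact ⟨0, fun h => absurd h hF⟩
  choose pick hpick using key
  let F : ℕ → Submodule ℝ Y := fun n =>
    Nat.rec (motive := fun _ => Submodule ℝ Y) ⊥ (fun n F => F ⊔ Submodule.span ℝ {pick n F}) n
  have hF0 : F 0 = ⊥ := rfl
  have hFs : ∀ n, F (n + 1) = F n ⊔ Submodule.span ℝ {pick n (F n)} := fun n => rfl
  have hFd : ∀ n : ℕ, FiniteDimensional ℝ ↥(F n) := by
    intro n
    induction n with
    | zero => rw [hF0]; infer_instance
    | succ n ih => rw [hFs]; infer_instance
  have hS : ∀ (a : ℕ → ℝ) n, ∑ i ∈ Finset.range n, a i • pick i (F i) ∈ F n := by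
    intro a n
    induction n with
    | zero => simp
    | succ n ih =>
      rw [Finset.sum_range_succ, hFs]
      exact Submodule.add_mem_sup ih
        (Submodule.smul_mem _ _ (Submodule.mem_span_singleton_self _))
  refine ⟨fun n => pick n (F n), fun n => (hpick n _ (hFd n)).1, ?_,
    fun n => (hpick n _ (hFd n)).2.1⟩
  intro a m n hmn
  have hmono : K m * ‖∑ i ∈ Finset.range m, a i • pick i (F i)‖ ≤
      K n * ‖∑ i ∈ Finset.range n, a i • pick i (F i)‖ := by
    induction n, hmn using Nat.le_induction with
    | base => exact le_rfl
    | succ n _ ih =>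
      refine ih.trans ?_
      rw [Finset.sum_range_succ]
      exact (hpick n _ (hFd n)).2.2 _ (hS a n) (a n)
  have e1 := mul_le_mul_of_nonneg_right (hK1 m)
    (norm_nonneg (∑ i ∈ Finset.range m, a i • pick i (F i)))
  have e2 := mul_le_mul_of_nonneg_right (hK2 n)
    (norm_nonneg (∑ i ∈ Finset.range n, a i • pick i (F i)))
  show ‖∑ i ∈ Finset.range m, a i • pick i (F i)‖ ≤
    2 * ‖∑ i ∈ Finset.range n, a i • pick i (F i)‖
  linarith

end
end
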